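/- arXiv:1705.02066 — 3 statements merged into one kernel-verified Lean document; each statement's English description precedes it below -/
import Mathlib

section
/- Let Γ be a primitive strongly regular graph with eigenvalues k, e⁺, e⁻ (multiplicity m⁻ of e⁻) satisfying v·e⁻ = m⁻(e⁻ − k), and let Y and Z be two distinct Delsarte cocliques of Γ. Then every vertex of Γ that lies in neither Y nor Z has exactly e⁺ neighbors in Y ∩ Z. -/
/-- `Y` is a coclique (independent set) in the graph `G`. -/
def IsCoclique {V : Type*} (G : SimpleGraph V) (Y : Finset V) : Prop :=
  ∀ x ∈ Y, ∀ y ∈ Y, ¬ G.Adj x y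

/-- `Y` is a Delsarte coclique: an independent set whose size equals
`v * e⁻ / (e⁻ - k)`, i.e. meeting Hoffman's ratio bound with equality. -/
def IsDelsarteCoclique {V : Type*} (G : SimpleGraph V) (v k : ℕ) (eN : ℤ)
    (Y : Finset V) : Prop :=
  IsCoclique G Y ∧ (Y.card : ℤ) * (eN - (k : ℤ)) = (v : ℤ) * eN

/-- A symmetric matrix proportional to an idempotent kills its isotropic vectors. -/
theorem mulVec_eq_zero_of_mul_self_eq_smul {V : Type*} [Fintype V] {B : Matrix V V ℚ}
    (hs : B.IsSymm) {c : ℚ} (hB : B * B = c • B) {w : V → ℚ}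
    (h : dotProduct w (B.mulVec w) = 0) : B.mulVec w = 0 := by
  rw [← dotProduct_self_eq_zero]
  have h1 : dotProduct (B.mulVec w) (B.mulVec w) = dotProduct w ((B * B).mulVec w) := by
    rw [← Matrix.mulVec_mulVec, Matrix.dotProduct_mulVec w, ← Matrix.mulVec_transpose, hs.eq]
  rw [h1, hB, Matrix.smul_mulVec, dotProduct_smul, h, smul_zero]

/-- In a strongly regular graph, the counting identity for the parameters, factored through
the nontrivial eigenvalues `c` and `d`. -/
theorem SimpleGraph.IsSRGWith.mul_eigenvalue_sub {V : Type*} [Fintype V] [DecidableEq V]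
    [Nonempty V] {G : SimpleGraph V} [DecidableRel G.Adj] {v k l m : ℕ}
    (hsrg : G.IsSRGWith v k l m) {c d : ℚ} (hsum : c + d = l - m) (hprod : c * d = m - k) :
    ((k : ℚ) - c) * (k - d) = m * v := by
  have hv : 0 < v := hsrg.card ▸ Fintype.card_pos
  have hp := SimpleGraph.IsSRGWith.param_eq G hsrg hv
  have hkv : k + 1 ≤ v := by
    obtain ⟨x⟩ := ‹Nonempty V›
    have := G.degree_lt_card_verts x
    rw [hsrg.regular.degree_eq, hsrg.card] at this
    exact this
  have hlk : ((k * (k - l - 1) : ℕ) : ℤ) = k * ((k : ℤ) - l - 1) := by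
    rcases Nat.eq_zero_or_pos k with rfl | hk
    · simp
    · obtain ⟨x⟩ := ‹Nonempty V›
      have hdeg : 0 < G.degree x := by rw [hsrg.regular.degree_eq]; exact hk
      obtain ⟨y, hy⟩ := (G.degree_pos_iff_exists_adj x).1 hdeg
      have h1 := hy.card_commonNeighbors_lt_degree
      rw [hsrg.of_adj x y hy, hsrg.regular.degree_eq] at h1
      rw [Nat.cast_mul, Nat.sub_sub, Nat.cast_sub h1]
      push_cast
      ring
  have hp' : (k : ℤ) * ((k : ℤ) - l - 1) = ((v : ℤ) - k - 1) * m := by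
    rw [← hlk, hp, Nat.cast_mul, Nat.sub_sub, Nat.cast_sub hkv]
    push_cast
    ring
  have hq : (k : ℚ) * ((k : ℚ) - l - 1) = ((v : ℚ) - k - 1) * m := by exact_mod_cast hp'
  linear_combination hq - (k : ℚ) * hsum + hprod

open Finset in
/-- If `u` is isotropic for the form of `A - c I - ((k - c) / v) J`, then `u` is in its kernel. -/
theorem SimpleGraph.IsSRGWith.eigenvalue_form_kernel {V : Type*} [Fintype V] [DecidableEq V]
    [Nonempty V] {G : SimpleGraph V} [DecidableRel G.Adj] {v k l m : ℕ}
    (hsrg : G.IsSRGWith v k l m) {c d : ℚ} (hsum : c + d = l - m) (hprod : c * d = m - k)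
    {u : V → ℚ}
    (h : ∑ j, u j * ((∑ i, G.adjMatrix ℚ j i * u i) - c * u j - (k - c) / v * ∑ i, u i) = 0)
    (j : V) :
    (∑ i, G.adjMatrix ℚ j i * u i) - c * u j - (k - c) / v * ∑ i, u i = 0 := by
  have hv : (v : ℚ) ≠ 0 := by
    have : 0 < v := hsrg.card ▸ Fintype.card_pos
    positivity
  have hdeg (a : V) : #{x | G.Adj a x} = k := by
    rw [← G.neighborFinset_eq_filter, G.card_neighborFinset_eq_degree, hsrg.regular.degree_eq]
  set A := G.adjMatrix ℚ with hA
  set g : ℚ := (k - c) / v with hg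
  set J : Matrix V V ℚ := Matrix.of fun _ _ => 1 with hJ
  have hAA : A * A = (c + d) • A - (c * d) • 1 + (m : ℚ) • J := by
    have h1 := hsrg.matrix_eq (α := ℚ)
    rw [pow_two] at h1
    rw [hA, h1, hsum, hprod]
    ext a b
    simp only [Matrix.add_apply, Matrix.sub_apply, Matrix.smul_apply]
    by_cases hab : a = b
    · subst hab
      simp [hJ, SimpleGraph.adjMatrix_apply]
    · by_cases hadj : G.Adj a b <;>
        simp [hJ, SimpleGraph.adjMatrix_apply, hab, hadj]
  have hAJ : A * J = (k : ℚ) • J := by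
    ext a b
    simp [hA, hJ, Matrix.mul_apply, SimpleGraph.adjMatrix_apply, hdeg]
  have hJA : J * A = (k : ℚ) • J := by
    ext a b
    simp [hA, hJ, Matrix.mul_apply, SimpleGraph.adjMatrix_apply, G.adj_comm _ b,
      hdeg]
  have hJJ : J * J = (v : ℚ) • J := by
    ext a b
    simp [hJ, Matrix.mul_apply, hsrg.card]
  set B : Matrix V V ℚ := A - c • 1 - g • J with hB
  have hsymm : B.IsSymm := by
    ext a b
    simp [hB, hA, hJ, Matrix.one_apply, G.adj_comm a b, eq_comm (a := a)]
  have hgv : g * v = k - c := by rw [hg]; field_simp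
  have hgd : g * (k - d) = m := by
    have := hsrg.mul_eigenvalue_sub hsum hprod
    rw [hg]; field_simp; linarith
  have hBB : B * B = (d - c) • B := by
    rw [hB]
    simp only [sub_mul, mul_sub, hAA, Matrix.smul_mul, Matrix.mul_smul, hAJ, hJA, hJJ, mul_one,
      one_mul]
    ext a b
    simp only [Matrix.sub_apply, Matrix.add_apply, Matrix.smul_apply, smul_eq_mul]
    linear_combination (J a b) * (g * hgv - hgd)
  have hBu (a : V) : B.mulVec u a = (∑ i, A a i * u i) - c * u a - g * ∑ i, u i := by
    rw [hB, Matrix.sub_mulVec, Matrix.sub_mulVec, Matrix.smul_mulVec, Matrix.smul_mulVec]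
    simp [Matrix.mulVec, dotProduct, hJ]
  have hker := mulVec_eq_zero_of_mul_self_eq_smul hsymm hBB (w := u) (by
    simp only [dotProduct, hBu]; exact h)
  rw [← hBu, hker, Pi.zero_apply]

/-- A connected graph whose adjacency relation is transitive is complete. -/
theorem SimpleGraph.Connected.adj_of_ne_of_trans {V : Type*} {G : SimpleGraph V}
    (hG : G.Connected) (htrans : ∀ a b c, a ≠ c → G.Adj a b → G.Adj b c → G.Adj a c)
    {a b : V} (hab : a ≠ b) : G.Adj a b := by
  obtain ⟨p⟩ := hG.preconnected a b
  induction p with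
  | nil => exact absurd rfl hab
  | @cons u w z huw p ih =>
    by_cases hwz : w = z
    · exact hwz ▸ huw
    · exact htrans _ _ _ hab huw (ih hwz)

/-- In a strongly regular graph which is connected but not complete, `μ ≠ 0`. -/
theorem SimpleGraph.IsSRGWith.mu_ne_zero {V : Type*} [Fintype V] [DecidableEq V]
    [Nontrivial V] {G : SimpleGraph V} [DecidableRel G.Adj] {v k l m : ℕ}
    (hsrg : G.IsSRGWith v k l m) (hconn : G.Connected) (hconnCompl : Gᶜ.Connected) : m ≠ 0 := by
  rintro rfl
  obtain ⟨a⟩ := hconn.nonempty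
  obtain ⟨b, hab⟩ := hconnCompl.preconnected.exists_adj_of_nontrivial a
  rw [SimpleGraph.compl_adj] at hab
  refine hab.2 (hconn.adj_of_ne_of_trans (fun a b c hac h1 h2 => ?_) hab.1)
  by_contra h
  have h0 := hsrg.of_not_adj hac h
  rw [Fintype.card_eq_zero_iff] at h0
  exact h0.false ⟨b, h1, h2.symm⟩

theorem IsCoclique.sum_adjMatrix_eq_zero {V : Type*} {G : SimpleGraph V}
    [DecidableRel G.Adj] {Y : Finset V} (hY : IsCoclique G Y) {x : V} (hx : x ∈ Y) :
    ∑ y ∈ Y, G.adjMatrix ℚ x y = 0 :=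
  Finset.sum_eq_zero fun y hy => by simp [SimpleGraph.adjMatrix_apply, hY x hx y hy]

/-- A vertex outside a Delsarte coclique has exactly `-e⁻` neighbors in it. -/
theorem IsDelsarteCoclique.sum_adjMatrix {V : Type*} [Fintype V] [DecidableEq V]
    {G : SimpleGraph V} [DecidableRel G.Adj] {v k l m : ℕ} {eP eN : ℤ}
    (hsrg : G.IsSRGWith v k l m)
    (hsum : (eN : ℚ) + eP = l - m) (hprod : (eN : ℚ) * eP = m - k)
    {Y : Finset V} (hY : IsDelsarteCoclique G v k eN Y) {x : V} (hx : x ∉ Y) :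
    ∑ y ∈ Y, G.adjMatrix ℚ x y = -eN := by
  have : Nonempty V := ⟨x⟩
  have hv : (v : ℚ) ≠ 0 := by
    have : 0 < v := hsrg.card ▸ Fintype.card_pos
    positivity
  have hc : ((k : ℚ) - eN) / v * Y.card = -eN := by
    have h : (Y.card : ℚ) * (eN - k) = v * eN := by exact_mod_cast hY.2
    field_simp
    linarith
  have hker := hsrg.eigenvalue_form_kernel hsum hprod (u := fun i => if i ∈ Y then 1 else 0)
    (Finset.sum_eq_zero fun j _ => by
      by_cases hj : j ∈ Y
      · have := hY.1.sum_adjMatrix_eq_zero hj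
        simp [hj, hc, -SimpleGraph.adjMatrix_apply, this]
      · simp [hj]) x
  simp [hx, hc, -SimpleGraph.adjMatrix_apply] at hker
  linarith

/-- When Hoffman's and Cvetković's bounds agree, the number of common neighbors in a Delsarte
coclique `Y` of two vertices outside `Y` is determined by their adjacency. -/
theorem IsDelsarteCoclique.sum_adjMatrix_mul_adjMatrix {V : Type*} [Fintype V] [DecidableEq V]
    {G : SimpleGraph V} [DecidableRel G.Adj] {v k l m : ℕ} {eP eN : ℤ}
    (hsrg : G.IsSRGWith v k l m) (hk : k ≠ 0) (heP : 0 ≤ eP) (heN : eN < 0)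
    (hsum : (eN : ℚ) + eP = l - m) (hprod : (eN : ℚ) * eP = m - k)
    (hbound : (k : ℚ) * (eP + 1) = -eN * (eP - eN))
    {Y : Finset V} (hY : IsDelsarteCoclique G v k eN Y) {x z : V} (hx : x ∉ Y) (hz : z ∉ Y) :
    ∑ y ∈ Y, G.adjMatrix ℚ x y * G.adjMatrix ℚ z y =
      -eN - eP ^ 2 - eP * G.adjMatrix ℚ x z + if z = x then (eP : ℚ) ^ 2 else 0 := by
  have : Nonempty V := ⟨x⟩
  have hdeg (j : V) (hj : j ∉ Y) := hY.sum_adjMatrix hsrg hsum hprod hj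
  have hv : (v : ℚ) ≠ 0 := by
    have : 0 < v := hsrg.card ▸ Fintype.card_pos
    positivity
  have hc : (Y.card : ℚ) * (k - eN) = - v * eN := by
    have h : (Y.card : ℚ) * (eN - k) = v * eN := by exact_mod_cast hY.2
    linarith
  have hparam := hsrg.mul_eigenvalue_sub hsum hprod
  have heN' : (eN : ℚ) < 0 := by exact_mod_cast heN
  have heP' : (0 : ℚ) ≤ eP := by exact_mod_cast heP
  have hk' : (0 : ℚ) < k := by positivity
  set r : ℚ := (eP : ℚ)
  obtain ⟨s, hs⟩ : ∃ s : ℚ, (eN : ℚ) = -s := ⟨-eN, by ring⟩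
  rw [hs] at hdeg hc hparam heN' hbound hsum hprod ⊢
  simp only [neg_neg] at hdeg ⊢
  obtain ⟨ρ, hρ⟩ : ∃ ρ : ℚ, ρ * k = m := ⟨m / k, by field_simp⟩
  have hρ' : ρ * (r + s) = s - r ^ 2 := by
    apply mul_right_cancel₀ hk'.ne'
    linear_combination (r + s) * hρ - (r + s) * hprod + r * hbound
  have hg : ((k : ℚ) - r) / v * (r + s - ρ * Y.card) = r * ρ := by
    have hks : (k : ℚ) + s ≠ 0 := by linarith
    rw [div_mul_eq_mul_div, div_eq_iff hv]
    apply mul_right_cancel₀ hks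
    linear_combination (r + s) * hparam - (r + s) * v * hρ - ρ * (k - r) * hc
  set A := G.adjMatrix ℚ with hA
  have hsymm (i j : V) : A i j = A j i := by simp [hA, G.adj_comm]
  have hAA (i j : V) : A i j * A i j = A i j := by simp [hA]
  set w : V → ℚ := fun i => (if i = x then r else 0) + if i ∈ Y then A x i - ρ else 0 with hw
  have hwsum : ∑ i, w i = r + s - ρ * Y.card := by
    simp only [hw, Finset.sum_add_distrib, Finset.sum_ite_eq', Finset.mem_univ, if_true,
      Finset.sum_ite_mem, Finset.univ_inter, Finset.sum_sub_distrib, hdeg x hx,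
      Finset.sum_const, nsmul_eq_mul]
    ring
  have hAw (j : V) : ∑ i, A j i * w i =
      r * A x j + ∑ y ∈ Y, A x y * A j y - ρ * ∑ y ∈ Y, A j y := by
    simp only [hw, mul_add, mul_ite, mul_zero, Finset.sum_add_distrib, Finset.sum_ite_eq',
      Finset.mem_univ, if_true, Finset.sum_ite_mem, Finset.univ_inter, mul_sub,
      Finset.sum_sub_distrib, hsymm j x, ← Finset.sum_mul]
    simp only [mul_comm]
    ring
  have hzero (j : V) (hj : j ∈ Y) : ∑ i, A j i * w i = r * A x j := by
    have h1 : ∑ y ∈ Y, A x y * A j y = 0 := Finset.sum_eq_zero fun y hy => by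
      simp [hA, hY.1 j hj y hy]
    rw [hAw, h1, hY.1.sum_adjMatrix_eq_zero hj]
    ring
  have hker := hsrg.eigenvalue_form_kernel (c := r) (d := -s) (by linarith) (by linarith)
    (u := w) (Finset.sum_eq_zero fun j _ => by
      rw [hwsum, hg]
      by_cases hj : j ∈ Y
      · have hjx : j ≠ x := fun h => hx (h ▸ hj)
        rw [← hA, hzero j hj]
        simp only [hw, hj, hjx, if_true, if_false]
        ring
      · by_cases hjx : j = x
        · subst hjx
          have h1 : A j j = 0 := by simp [hA]
          rw [← hA, hAw, hdeg j hj]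
          simp only [hAA, hdeg j hj, h1, hw, hj, if_true, if_false]
          linear_combination -r * hρ'
        · simp [hw, hj, hjx]) z
  rw [hwsum, hg, ← hA, hAw, hdeg z hz] at hker
  simp only [hw, hz, if_false] at hker
  split_ifs at hker ⊢ <;> linear_combination hker + hρ'

/-- The agreement of Hoffman's and Cvetković's bounds as a relation between the eigenvalues. -/
theorem degree_mul_of_hoffman_eq_cvetkovic {v k m M r s : ℚ} (hv : 0 < v) (hm : 0 < m)
    (hk : 0 < k) (hr : 0 ≤ r) (hs : 0 < s) (hparam : (k - r) * (k + s) = m * v)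
    (hprod : m = k - r * s)
    (hmult : M = v - 1 - (-s + 1) * k * (k + s) / (m * (-s - r)))
    (hbound : v * -s = M * (-s - k)) : k * (r + 1) = s * (r + s) := by
  have hsr : (-s - r) ≠ 0 := by linarith
  have hkr : k - r ≠ 0 := by
    intro h
    rw [h, zero_mul] at hparam
    exact (mul_pos hm hv).ne hparam
  have hks : k + s ≠ 0 := by linarith
  have hM : M * m = s * (k - r) := by
    apply mul_right_cancel₀ hks
    linear_combination m * hbound - s * hparam
  have hmult' : M * (m * (-s - r)) = (v - 1) * (m * (-s - r)) - (-s + 1) * k * (k + s) := by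
    rw [hmult]; field_simp
  apply mul_left_cancel₀ hkr
  linear_combination hmult' - (-s - r) * hM - (-s - r) * hparam + (s + r) * hprod

theorem srg_two_delsarte_cocliques_outside_vertex
    {V : Type*} [Fintype V] [DecidableEq V] (G : SimpleGraph V) [DecidableRel G.Adj]
    (v k l m : ℕ) (eP eN : ℤ) (mN : ℕ)
    (hsrg : G.IsSRGWith v k l m)
    (hconn : G.Connected) (hconnCompl : Gᶜ.Connected)
    (heP : 0 ≤ eP) (heN : eN < 0)
    (hProot : eP ^ 2 - ((l : ℤ) - (m : ℤ)) * eP - ((k : ℤ) - (m : ℤ)) = 0)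
    (hNroot : eN ^ 2 - ((l : ℤ) - (m : ℤ)) * eN - ((k : ℤ) - (m : ℤ)) = 0)
    (hmult : (mN : ℚ) = (v : ℚ) - 1 -
      ((eN : ℚ) + 1) * (k : ℚ) * ((k : ℚ) - (eN : ℚ)) / ((m : ℚ) * ((eN : ℚ) - (eP : ℚ))))
    (hbound : (v : ℤ) * eN = (mN : ℤ) * (eN - (k : ℤ)))
    (Y Z : Finset V) (hY : IsDelsarteCoclique G v k eN Y)
    (hZ : IsDelsarteCoclique G v k eN Z) (hYZ : Y ≠ Z)
    (x : V) (hx : x ∉ Y) (hx' : x ∉ Z) :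
    (((Y ∩ Z).filter (fun y => G.Adj x y)).card : ℤ) = eP := by
  have : Nonempty V := ⟨x⟩
  have hv : 0 < v := hsrg.card ▸ Fintype.card_pos
  have hcard : Y.card = Z.card := by
    have h : (Y.card : ℤ) * (eN - k) = Z.card * (eN - k) := hY.2.trans hZ.2.symm
    exact_mod_cast mul_right_cancel₀ (by omega) h
  obtain ⟨z₀, hz₀⟩ : (Z \ Y).Nonempty := by
    rw [Finset.sdiff_nonempty]
    exact fun h => hYZ (Finset.eq_of_subset_of_card_le h hcard.le).symm
  have : Nontrivial V := ⟨z₀, x, fun h => hx' (h ▸ (Finset.mem_sdiff.1 hz₀).1)⟩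
  have hm0 := hsrg.mu_ne_zero hconn hconnCompl
  have hk0 : k ≠ 0 := by
    obtain ⟨b, hb⟩ := hconn.preconnected.exists_adj_of_nontrivial x
    rw [← hsrg.regular.degree_eq x]
    exact ((G.degree_pos_iff_exists_adj x).2 ⟨b, hb⟩).ne'
  have hsumZ : eN + eP = l - m := by
    apply mul_left_cancel₀ (show eP - eN ≠ 0 by omega)
    linear_combination hProot - hNroot
  have hprodZ : eN * eP = m - k := by
    linear_combination eP * hsumZ - hProot
  have hsum : (eN : ℚ) + eP = l - m := by exact_mod_cast hsumZ
  have hprod : (eN : ℚ) * eP = m - k := by exact_mod_cast hprodZ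
  have hPN : (eP : ℚ) - eN ≠ 0 := by
    have : eP - eN ≠ 0 := by omega
    exact_mod_cast this
  have hrel : (k : ℚ) * (eP + 1) = -eN * (eP - eN) := by
    have hb : (v : ℚ) * eN = mN * (eN - k) := by exact_mod_cast hbound
    have := degree_mul_of_hoffman_eq_cvetkovic (v := v) (k := k) (m := m) (M := mN) (r := eP)
      (s := -eN) (by positivity) (by positivity) (by positivity) (by exact_mod_cast heP)
      (by exact_mod_cast neg_pos.2 heN)
      (by linear_combination hsrg.mul_eigenvalue_sub hsum hprod) (by linarith)
      (by rw [hmult]; simp [sub_eq_add_neg]) (by simpa using hb)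
    linarith
  set A := G.adjMatrix ℚ with hA
  have hsymm (i j : V) : A i j = A j i := by simp [hA, G.adj_comm]
  set t : V → ℚ := fun p => ∑ y ∈ Y ∩ Z, A p y with ht
  have hsplit (p : V) : ∑ z ∈ Z \ Y, A p z = ∑ z ∈ Z, A p z - t p := by
    rw [eq_sub_iff_add_eq, add_comm, ht, Finset.inter_comm]
    exact Finset.sum_inter_add_sum_sdiff Z Y _
  have hcount (p : V) (hp : p ∉ Y) :
      ∑ z ∈ Z \ Y, ∑ y ∈ Y, A p y * A z y = -eN * (-eN - t p) := by
    have h2 : ∑ y ∈ Y \ Z, A p y = -eN - t p := by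
      rw [← hY.sum_adjMatrix hsrg hsum hprod hp, ← hA, eq_sub_iff_add_eq, add_comm]
      exact Finset.sum_inter_add_sum_sdiff Y Z _
    rw [Finset.sum_comm, ← h2, ← Finset.sum_inter_add_sum_sdiff Y Z, Finset.sum_eq_zero,
      zero_add, Finset.mul_sum]
    · refine Finset.sum_congr rfl fun y hy => ?_
      rw [Finset.mem_sdiff] at hy
      have h0 : t y = 0 := Finset.sum_eq_zero fun z hz => by
        simp [hA, hY.1 y hy.1 z (Finset.mem_inter.1 hz).1]
      have h1 := hsplit y
      rw [h0, hZ.sum_adjMatrix hsrg hsum hprod hy.2] at h1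
      simp only [← Finset.mul_sum, hsymm _ y, h1]
      ring
    · intro y hy
      refine Finset.sum_eq_zero fun z hz => ?_
      rw [Finset.mem_inter] at hy
      simp [hA, hZ.1 z (Finset.mem_sdiff.1 hz).1 y hy.2]
  have hcount' (p : V) (hp : p ∉ Y) : -eN * (-eN - t p) =
      (Z \ Y).card * (-eN - (eP : ℚ) ^ 2) - eP * (∑ z ∈ Z, A p z - t p) +
        if p ∈ Z \ Y then (eP : ℚ) ^ 2 else 0 := by
    rw [← hcount p hp, Finset.sum_congr rfl fun z hz =>
      hY.sum_adjMatrix_mul_adjMatrix hsrg hk0 heP heN hsum hprod hrel hp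
        (Finset.mem_sdiff.1 hz).2, ← hsplit]
    simp only [Finset.sum_add_distrib, Finset.sum_sub_distrib, Finset.sum_const, nsmul_eq_mul,
      ← Finset.mul_sum, Finset.sum_ite_eq', ← hA]
    ring
  have h1 := hcount' x hx
  have h2 := hcount' z₀ (Finset.mem_sdiff.1 hz₀).2
  have hz₀Z := (Finset.mem_sdiff.1 hz₀).1
  have ht0 : t z₀ = 0 := Finset.sum_eq_zero fun z hz => by
    simp [hA, hZ.1 z₀ hz₀Z z (Finset.mem_inter.1 hz).2]
  rw [hZ.sum_adjMatrix hsrg hsum hprod hx', if_neg (by simp [hx'])] at h1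
  rw [hZ.1.sum_adjMatrix_eq_zero hz₀Z, ht0, if_pos hz₀] at h2
  have htx : t x = eP := by
    apply mul_left_cancel₀ hPN
    linear_combination h2 - h1
  have hfin : t x = (((Y ∩ Z).filter (fun y => G.Adj x y)).card : ℚ) := by
    simp [ht, hA, SimpleGraph.adjMatrix_apply]
  rw [hfin] at htx
  exact_mod_cast htx
end

section
/- Let Γ be a primitive strongly regular graph with eigenvalues k, e⁺, e⁻ (multiplicity m⁻ of e⁻) satisfying v·e⁻ = m⁻(e⁻ − k), and suppose Γ has exactly m⁻ + 1 distinct Delsarte cocliques Y₁, …, Y_{m⁻+1}. Then every vertex of Γ lies in exactly 1 + (e⁻ + 1)e⁺/((e⁺)² + e⁻) of these Delsarte cocliques, and the family of sets { Y₁ ∩ Y_i : 2 ≤ i ≤ m⁻ + 1 }, viewed as subsets of Y₁, forms a symmetric 2-(m⁻, (e⁻ + 1)e⁺/((e⁺)² + e⁻), (−(e⁺)² + e⁺)/((e⁺)² + e⁻)) design (every point of Y₁ lies in exactly (e⁻ + 1)e⁺/((e⁺)² + e⁻) of these sets and every pair of distinct points of Y₁ lies in exactly (−(e⁺)² + e⁺)/((e⁺)²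 + e⁻) of them). -/
section

open Matrix

/-- A rational symmetric matrix whose square has trace zero vanishes. -/
theorem Matrix.IsSymm.eq_zero_of_trace_mul_self {n : Type*} [Fintype n] {F : Matrix n n ℚ}
    (hF : F.IsSymm) (h : (F * F).trace = 0) : F = 0 := by
  rw [← Matrix.trace_conjTranspose_mul_self_eq_zero_iff,
    Matrix.conjTranspose_eq_transpose_of_trivial, hF.eq, h]

/-- A symmetric idempotent `E` is recovered from a symmetric `M` with `M E M = M` as soon as
the idempotent `E M` has full rank, expressed here through traces. -/
theorem Matrix.IsSymm.mul_mul_self_eq_of_trace {n : Type*} [Fintype n] {E M : Matrix n n ℚ}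
    (hE : E.IsSymm) (hEE : E * E = E) (hM : M.IsSymm) (hMEM : M * E * M = M)
    (htr : (M * E).trace = E.trace) : E * M * E = E := by
  have hsymm : (E - E * M * E).IsSymm := by
    simp only [IsSymm, transpose_sub, transpose_mul, hE.eq, hM.eq, Matrix.mul_assoc]
  have h1 : E * (E * M * E) = E * M * E := by
    rw [← Matrix.mul_assoc, ← Matrix.mul_assoc, hEE]
  have h2 : E * M * E * E = E * M * E := by rw [Matrix.mul_assoc, hEE]
  have h3 : E * M * E * (E * M * E) = E * M * E := by
    calc E * M * E * (E * M * E) = E * M * (E * E) * (M * E) := by noncomm_ring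
      _ = E * (M * E * M) * E := by rw [hEE]; noncomm_ring
      _ = E * M * E := by rw [hMEM]
  have hsq : (E - E * M * E) * (E - E * M * E) = E - E * M * E := by
    rw [Matrix.sub_mul, Matrix.mul_sub, Matrix.mul_sub, hEE, h1, h2, h3]
    abel
  have htr' : (E * M * E).trace = E.trace := by
    rw [Matrix.mul_assoc, Matrix.trace_mul_comm, Matrix.mul_assoc, hEE, htr]
  refine (sub_eq_zero.1 (hsymm.eq_zero_of_trace_mul_self ?_)).symm
  rw [hsq, trace_sub, htr', sub_self]

/-- If the principal submatrix on `Y` of a symmetric idempotent `E` of trace `|Y|` is the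
invertible matrix `(a - b) I + b J`, then the norm of any vector fixed by `E` is a quadratic form
in its restriction to `Y`. -/
theorem Matrix.IsSymm.dotProduct_self_of_fixed {n : Type*} [Fintype n] [DecidableEq n]
    {E : Matrix n n ℚ} (hE : E.IsSymm) (hEE : E * E = E) {Y : Finset n}
    (htr : E.trace = Y.card) {a b α β : ℚ}
    (hdiag : ∀ y ∈ Y, E y y = a) (hoff : ∀ y ∈ Y, ∀ z ∈ Y, y ≠ z → E y z = b)
    (hα : α * (a - b) = 1) (hβ : α * b + β * (a - b) + β * b * Y.card = 0)
    {w : n → ℚ} (hw : E *ᵥ w = w) :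
    w ⬝ᵥ w = α * ∑ y ∈ Y, w y ^ 2 + β * (∑ y ∈ Y, w y) ^ 2 := by
  set χ : n → ℚ := fun x => if x ∈ Y then 1 else 0 with hχ
  set D : Matrix n n ℚ := diagonal χ with hD
  set X : Matrix n n ℚ := vecMulVec χ χ with hX
  set M : Matrix n n ℚ := α • D + β • X with hMdef
  have hχχ : χ * χ = χ := by ext x; simp [hχ]
  have hsum : χ ⬝ᵥ χ = Y.card := by simp [hχ, dotProduct]
  have hDχ : D *ᵥ χ = χ := by rw [hD]; ext x; simp [mulVec_diagonal, hχ]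
  have hχD : χ ᵥ* D = χ := by rw [hD]; ext x; simp [vecMul_diagonal, hχ]
  have hDD : D * D = D := by rw [hD, diagonal_mul_diagonal']; exact congrArg _ hχχ
  have hDX : D * X = X := by rw [hX, mul_vecMulVec, hDχ]
  have hXD : X * D = X := by rw [hX, vecMulVec_mul, hχD]
  have hXX : X * X = (Y.card : ℚ) • X := by
    rw [hX, vecMulVec_mul_vecMulVec, hsum, vecMulVec_smul]
  have hMs : M.IsSymm := by
    simp [IsSymm, hMdef, hD, hX, transpose_vecMulVec]
  have hDM : D * M = M := by simp [hMdef, Matrix.mul_add, hDD, hDX]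
  have hMD : M * D = M := by simp [hMdef, Matrix.add_mul, hDD, hXD]
  have hgram : D * E * D = (a - b) • D + b • X := by
    ext x y
    simp only [hD, mul_diagonal, diagonal_mul, Matrix.add_apply, Matrix.smul_apply, hX,
      vecMulVec_apply, diagonal_apply, hχ, smul_eq_mul]
    by_cases hx : x ∈ Y <;> by_cases hy : y ∈ Y <;> by_cases hxy : x = y
    · subst hxy; simp [hx, hdiag]
    · simp [hx, hy, hxy, hoff x hx y hy hxy]
    all_goals first | (subst hxy; simp_all) | simp_all
  have hMg : M * (D * E * D) = D := by
    rw [hgram, hMdef]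
    simp only [Matrix.add_mul, Matrix.mul_add, Matrix.smul_mul, Matrix.mul_smul, hDD, hDX, hXD,
      hXX, smul_smul]
    have : D = (1 : ℚ) • D + (0 : ℚ) • X := by simp
    conv_rhs => rw [this, ← hα, ← hβ]
    module
  have hMED : M * E * D = D := by
    calc M * E * D = M * D * E * D := by rw [hMD]
      _ = M * (D * E * D) := by simp only [Matrix.mul_assoc]
      _ = D := hMg
  have hMEM : M * E * M = M := by
    nth_rw 2 [← hDM]
    rw [← Matrix.mul_assoc, hMED, hDM]
  have htr' : (M * E).trace = E.trace := by
    have : (M * E).trace = (M * E * D).trace := by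
      rw [Matrix.trace_mul_comm (M * E), ← Matrix.mul_assoc, hDM]
    rw [this, hMED, htr, hD, trace_diagonal]
    simp [hχ]
  have key := hE.mul_mul_self_eq_of_trace hEE hMs hMEM htr'
  have hw' : w ᵥ* E = w := by
    rw [← mulVec_transpose, hE.eq, hw]
  have hχw : χ ⬝ᵥ w = ∑ y ∈ Y, w y := by simp [hχ, dotProduct]
  calc w ⬝ᵥ w = w ⬝ᵥ (E *ᵥ w) := by rw [hw]
    _ = w ⬝ᵥ ((E * M * E) *ᵥ w) := by rw [key]
    _ = (w ᵥ* E) ⬝ᵥ (M *ᵥ (E *ᵥ w)) := by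
      rw [← dotProduct_mulVec, mulVec_mulVec, mulVec_mulVec, Matrix.mul_assoc]
    _ = w ⬝ᵥ (M *ᵥ w) := by rw [hw, hw']
    _ = _ := by
      rw [hMdef, add_mulVec, smul_mulVec, smul_mulVec, dotProduct_add, dotProduct_smul,
        dotProduct_smul, hX, vecMulVec_mulVec, ← hχw, hD]
      have h1 : w ⬝ᵥ (diagonal χ *ᵥ w) = ∑ y ∈ Y, w y ^ 2 := by
        simp [dotProduct, mulVec_diagonal, hχ, sq, mul_ite]
      rw [h1, dotProduct_comm χ w]
      simp [sq, dotProduct_smul]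

/-- A regular simplex of `1 + trace E` vectors in the image of a symmetric idempotent `E` is
centred at the origin and is a tight frame for that image. -/
theorem Matrix.IsSymm.simplex_in_range {n ι : Type*} [Fintype n] [Fintype ι] [DecidableEq ι]
    {E : Matrix n n ℚ} (hE : E.IsSymm) (hEE : E * E = E) {c d : ℚ} (htr : E.trace = c)
    (hι : (Fintype.card ι : ℚ) = c + 1) {w : ι → n → ℚ} (hw : ∀ i, E *ᵥ w i = w i)
    (hdot : ∀ i j, w i ⬝ᵥ w j = if i = j then c * d else -d) :
    (∀ x, ∑ i, w i x = 0) ∧ ∀ x y, ∑ i, w i x * w i y = (c + 1) * d * E x y := by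
  have hrow : ∀ i, ∑ j, w i ⬝ᵥ w j = 0 := by
    intro i
    have : ∀ j, w i ⬝ᵥ w j = (if i = j then (c + 1) * d else 0) + -d := by
      intro j; rw [hdot]; split_ifs <;> ring
    simp only [this, Finset.sum_add_distrib, Finset.sum_ite_eq, Finset.mem_univ, if_true,
      Finset.sum_const, Finset.card_univ, nsmul_eq_mul, hι]
    ring
  have h0 : ∑ i, w i = 0 := by
    apply dotProduct_self_eq_zero.1
    rw [sum_dotProduct]
    simp only [dotProduct_sum, hrow, Finset.sum_const_zero]
  constructor
  · intro x
    simpa using congrFun h0 x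
  · set F : Matrix n n ℚ := ∑ i, vecMulVec (w i) (w i) with hF
    have hFs : F.IsSymm := by simp [IsSymm, hF, transpose_sum, transpose_vecMulVec]
    have hEF : E * F = F := by simp [hF, Matrix.mul_sum, mul_vecMulVec, hw]
    have hFE : F * E = F := by
      have := congrArg Matrix.transpose hEF
      rwa [transpose_mul, hFs.eq, hE.eq] at this
    have hFtr : F.trace = (c + 1) * (c * d) := by
      simp [hF, trace_sum, trace_vecMulVec, hdot, hι]
    have hFF : F * F = ((c + 1) * d) • F := by
      have h1 : ∀ i, ∑ j, (w i ⬝ᵥ w j) • w j = ((c + 1) * d) • w i - d • ∑ j, w j := by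
        intro i
        have : ∀ j, w i ⬝ᵥ w j = (if i = j then (c + 1) * d else 0) + -d := by
          intro j; rw [hdot]; split_ifs <;> ring
        simp only [this, add_smul, Finset.sum_add_distrib, ite_smul, zero_smul,
          Finset.sum_ite_eq, Finset.mem_univ, if_true, neg_smul, Finset.sum_neg_distrib,
          Finset.smul_sum, sub_eq_add_neg]
      simp only [h0, smul_zero, sub_zero] at h1
      have h2 : ∀ i, vecMulVec (w i) (w i) * F = ((c + 1) * d) • vecMulVec (w i) (w i) := by
        intro i
        rw [hF, Matrix.mul_sum]
        simp only [vecMulVec_mul_vecMulVec]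
        rw [← vecMulVec_smul, ← h1 i]
        ext x y
        simp [vecMulVec_apply, Matrix.sum_apply, Finset.mul_sum, mul_left_comm]
      conv_lhs => rw [hF, Matrix.sum_mul]
      rw [← hF]
      simp only [h2, ← Finset.smul_sum, ← hF]
    have hz : F - ((c + 1) * d) • E = 0 := by
      apply IsSymm.eq_zero_of_trace_mul_self
      · simp [IsSymm, hFs.eq, hE.eq]
      · simp only [Matrix.sub_mul, Matrix.mul_sub, Matrix.smul_mul, Matrix.mul_smul, hFF, hEF,
          hFE, hEE, trace_sub, trace_smul, hFtr, htr, smul_eq_mul]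
        ring
    intro x y
    have := congrFun (congrFun (sub_eq_zero.1 hz) x) y
    simpa [hF, Matrix.sum_apply, vecMulVec_apply] using this

namespace SimpleGraph

variable {V : Type*} {G : SimpleGraph V} [DecidableRel G.Adj]
  {v k l m : ℕ}

theorem adjMatrix_mul_of_one_of_regular [Fintype V] (h : G.IsRegularOfDegree k) :
    G.adjMatrix ℚ * (of fun _ _ => 1 : Matrix V V ℚ) = (k : ℚ) • of fun _ _ => 1 := by
  ext x y
  simp [adjMatrix_mul_apply, h x]

theorem of_one_mul_adjMatrix_of_regular [Fintype V] (h : G.IsRegularOfDegree k) :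
    (of fun _ _ => 1 : Matrix V V ℚ) * G.adjMatrix ℚ = (k : ℚ) • of fun _ _ => 1 := by
  ext x y
  simp [mul_adjMatrix_apply, h y]

variable [DecidableEq V]

/-- The orthogonal projection onto the eigenspace of the eigenvalue `n` of a strongly regular
graph with eigenvalues `k`, `p`, `n`. -/
noncomputable def eigenProj (G : SimpleGraph V) [DecidableRel G.Adj] (p n t : ℚ) : Matrix V V ℚ :=
  (n - p)⁻¹ • (G.adjMatrix ℚ - p • 1 - t • of fun _ _ => 1)

theorem eigenProj_apply_self (p n t : ℚ) (x : V) :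
    G.eigenProj p n t x x = (n - p)⁻¹ * (-p - t) := by
  simp [eigenProj]

theorem eigenProj_apply_of_not_adj (p n t : ℚ) {x y : V} (hxy : x ≠ y) (ha : ¬ G.Adj x y) :
    G.eigenProj p n t x y = (n - p)⁻¹ * (-t) := by
  simp [eigenProj, hxy, ha]

theorem eigenProj_isSymm (p n t : ℚ) : (G.eigenProj p n t).IsSymm := by
  ext x y
  simp [eigenProj, Matrix.one_apply, adj_comm, eq_comm]

variable [Fintype V]

theorem IsSRGWith.adjMatrix_mul_self (h : G.IsSRGWith v k l m) :
    G.adjMatrix ℚ * G.adjMatrix ℚ = ((k : ℚ) - m) • (1 : Matrix V V ℚ)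
      + ((l : ℚ) - m) • G.adjMatrix ℚ + (m : ℚ) • of fun _ _ => 1 := by
  rw [← sq, h.matrix_eq]
  simp only [← Nat.cast_smul_eq_nsmul ℚ]
  ext x y
  by_cases hxy : x = y
  · subst hxy; simp
  · by_cases ha : G.Adj x y <;> simp [hxy, ha]

theorem IsSRGWith.param_eq_rat (h : G.IsSRGWith v k l m) [Nonempty V] :
    (k : ℚ) * k = k - m + (l - m) * k + m * v := by
  obtain ⟨x⟩ := ‹Nonempty V›
  have h1 := congrArg (· * (of fun _ _ => 1 : Matrix V V ℚ)) h.adjMatrix_mul_self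
  simp only [Matrix.mul_assoc, adjMatrix_mul_of_one_of_regular h.regular, Matrix.mul_smul,
    Matrix.add_mul, Matrix.smul_mul, Matrix.one_mul] at h1
  have h2 := congrFun (congrFun h1 x) x
  simpa [Matrix.mul_apply, h.card] using h2

theorem IsSRGWith.eigenProj_mul_self [Nonempty V] (h : G.IsSRGWith v k l m) {p n t : ℚ}
    (hsum : p + n = l - m) (hprod : p * n = m - k) (hpn : n ≠ p) (ht : t * v = k - p) :
    G.eigenProj p n t * G.eigenProj p n t = G.eigenProj p n t := by
  have hpn' : n - p ≠ 0 := sub_ne_zero.2 hpn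
  have hv : (v : ℚ) ≠ 0 := by
    rw [← h.card]; exact_mod_cast Fintype.card_ne_zero
  have hJJ : (of fun _ _ => 1 : Matrix V V ℚ) * (of fun _ _ => 1) = (v : ℚ) • of fun _ _ => 1 := by
    ext x y; simp [Matrix.mul_apply, h.card]
  have hpar := h.param_eq_rat
  have hm : (m : ℚ) - 2 * t * k + 2 * p * t + t * t * v = -(n - p) * t := by
    apply mul_right_cancel₀ hv
    linear_combination (t * v - k + n) * ht - hpar + k * hsum - hprod
  simp only [eigenProj, Matrix.smul_mul, Matrix.mul_smul, Matrix.sub_mul, Matrix.mul_sub,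
    h.adjMatrix_mul_self, adjMatrix_mul_of_one_of_regular h.regular,
    of_one_mul_adjMatrix_of_regular h.regular, hJJ, Matrix.mul_one, Matrix.one_mul]
  rw [← hsum, show (k : ℚ) - m = -(p * n) by linarith]
  have hm' : (m : ℚ) = -(n - p) * t + 2 * t * k - 2 * p * t - t * t * v := by linarith
  rw [hm']
  match_scalars <;> field_simp <;> ring

theorem IsSRGWith.eigenProj_mulVec_one (h : G.IsSRGWith v k l m) {p n t : ℚ}
    (ht : t * v = k - p) : G.eigenProj p n t *ᵥ 1 = 0 := by
  have hJ : (of fun _ _ => 1 : Matrix V V ℚ) *ᵥ 1 = fun _ => (v : ℚ) := by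
    ext x; simp [mulVec, dotProduct, h.card]
  ext x
  have hA : (G.adjMatrix ℚ *ᵥ 1) x = k := by
    simp [adjMatrix_mulVec_apply, h.regular x]
  simp only [eigenProj, smul_mulVec, sub_mulVec, one_mulVec, hJ, Pi.smul_apply, Pi.sub_apply, hA,
    Pi.one_apply, Pi.zero_apply, smul_eq_mul, ht]
  ring

omit [DecidableEq V] in
/-- A strongly regular graph with edges that is connected along with its complement has
`μ ≠ 0`. -/
theorem IsSRGWith.mu_ne_zero_s5 (h : G.IsSRGWith v k l m) (hG : G.Connected) (hGc : Gᶜ.Connected)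
    (hk : k ≠ 0) : m ≠ 0 := by
  classical
  rintro rfl
  have hadj : ∀ x y, G.Reachable x y → x = y ∨ G.Adj x y := by
    rintro x y ⟨w⟩
    induction w with
    | nil => exact Or.inl rfl
    | @cons a b c hab _ ih =>
      rcases ih with rfl | hbc
      · exact Or.inr hab
      · by_contra! hac
        have := h.of_not_adj hac.1 hac.2
        exact (Fintype.card_eq_zero_iff.1 this).false ⟨b, hab, hbc.symm⟩
  obtain ⟨x⟩ := hG.nonempty
  obtain ⟨y, hxy⟩ := (G.degree_pos_iff_exists_adj x).1 (by rw [h.regular x]; omega)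
  obtain ⟨w⟩ := hGc.preconnected x y
  cases w with
  | nil => exact G.loopless.irrefl _ hxy
  | cons hxb _ =>
    rw [compl_adj] at hxb
    exact (hadj _ _ (hG.preconnected _ _)).elim hxb.1 hxb.2

omit [DecidableEq V] in
/-- A strongly regular graph with edges and connected complement has `μ ≠ k`. -/
theorem IsSRGWith.mu_ne_degree (h : G.IsSRGWith v k l m) (hGc : Gᶜ.Connected)
    (hk : k ≠ 0) : m ≠ k := by
  classical
  rintro rfl
  have hstep : ∀ x y, x ≠ y → ¬ G.Adj x y → ∀ z, G.Adj x z → G.Adj y z := by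
    intro x y hxy ha z hz
    have h1 := h.of_not_adj hxy ha
    have h2 : (G.commonNeighbors x y).toFinset ⊆ G.neighborFinset x := by
      intro z hz
      simpa using (Set.mem_toFinset.1 hz).1
    have h3 := Finset.eq_of_subset_of_card_le h2 (by
      rw [Set.toFinset_card, h1, G.card_neighborFinset_eq_degree, h.regular x])
    have h4 : z ∈ (G.commonNeighbors x y).toFinset := by rw [h3]; simpa using hz
    exact (Set.mem_toFinset.1 h4).2
  have hreach : ∀ x y, Gᶜ.Reachable x y → ∀ z, G.Adj x z → G.Adj y z := by
    rintro x y ⟨w⟩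
    induction w with
    | nil => exact fun _ hz => hz
    | cons hab _ ih =>
      rw [compl_adj] at hab
      exact fun z hz => ih z (hstep _ _ hab.1 hab.2 z hz)
  obtain ⟨x⟩ := hGc.nonempty
  obtain ⟨y, hxy⟩ := (G.degree_pos_iff_exists_adj x).1 (by rw [h.regular x]; omega)
  exact G.loopless.irrefl y (hreach x y (hGc.preconnected _ _) y hxy)

end SimpleGraph

/-- The characteristic vector of `Y`, shifted by the constant `θ`. -/
def shiftedIndicator {V : Type*} [DecidableEq V] (θ : ℚ) (Y : Finset V) (x : V) : ℚ :=
  (if x ∈ Y then 1 else 0) - θ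

theorem shiftedIndicator_dotProduct {V : Type*} [Fintype V] [DecidableEq V] {θ c : ℚ}
    (hθ : θ * Fintype.card V = c) {Y Z : Finset V} (hY : (Y.card : ℚ) = c)
    (hZ : (Z.card : ℚ) = c) :
    shiftedIndicator θ Y ⬝ᵥ shiftedIndicator θ Z = (Y ∩ Z).card - c * θ := by
  have : ∀ x, shiftedIndicator θ Y x * shiftedIndicator θ Z x =
      (if x ∈ Y ∩ Z then 1 else 0) - θ * (if x ∈ Y then 1 else 0)
        - θ * (if x ∈ Z then 1 else 0) + θ * θ := by
    intro x
    by_cases hx : x ∈ Y <;> by_cases hx' : x ∈ Z <;> simp [shiftedIndicator, hx, hx'] <;> ring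
  simp only [dotProduct, this, Finset.sum_add_distrib, Finset.sum_sub_distrib, ← Finset.mul_sum,
    Finset.sum_ite_mem, Finset.univ_inter, Finset.sum_const, Finset.card_univ, nsmul_eq_mul,
    mul_one, hY, hZ]
  linear_combination θ * hθ

/-- If `E` is a symmetric idempotent with zero row sums, equal to `θ` on the diagonal and `b` off
the diagonal of `Y × Y`, then Hoffman's equality makes `E` fix the shifted indicator of `Y`. -/
theorem Matrix.IsSymm.mulVec_shiftedIndicator {V : Type*} [Fintype V] [DecidableEq V]
    {E : Matrix V V ℚ} (hE : E.IsSymm) (hEE : E * E = E) (hone : E *ᵥ 1 = 0) {θ c b : ℚ}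
    (hθ : θ * Fintype.card V = c) (hb : (c - 1) * b = 1 - 2 * θ) {Y : Finset V}
    (hY : (Y.card : ℚ) = c) (hdiag : ∀ y ∈ Y, E y y = θ)
    (hoff : ∀ y ∈ Y, ∀ z ∈ Y, y ≠ z → E y z = b) :
    E *ᵥ shiftedIndicator θ Y = shiftedIndicator θ Y := by
  set χ : V → ℚ := fun x => if x ∈ Y then 1 else 0 with hχ
  set u := shiftedIndicator θ Y with hu
  have huχ : u = χ - θ • (1 : V → ℚ) := by ext x; simp [hu, shiftedIndicator, hχ]
  have hEu : E *ᵥ u = E *ᵥ χ := by rw [huχ, mulVec_sub, mulVec_smul, hone]; simp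
  have hone' : (1 : V → ℚ) ᵥ* E = 0 := by rw [← mulVec_transpose, hE.eq, hone]
  have hrow : ∀ y ∈ Y, ∑ z ∈ Y, E y z = 1 - θ := by
    intro y hy
    rw [← Finset.add_sum_erase _ _ hy, hdiag y hy,
      Finset.sum_congr rfl fun z hz => hoff y hy z (Finset.mem_of_mem_erase hz)
        (Finset.ne_of_mem_erase hz).symm,
      Finset.sum_const, Finset.card_erase_of_mem hy, nsmul_eq_mul,
      Nat.cast_sub (Finset.card_pos.2 ⟨y, hy⟩), hY, Nat.cast_one, hb]
    ring
  have hχE : χ ⬝ᵥ (E *ᵥ χ) = c * (1 - θ) := by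
    simp only [dotProduct, mulVec, hχ, mul_ite, mul_one, mul_zero, ite_mul, one_mul, zero_mul,
      Finset.sum_ite_mem, Finset.univ_inter]
    rw [Finset.sum_congr rfl hrow, Finset.sum_const, nsmul_eq_mul, hY]
  have huEu : u ⬝ᵥ (E *ᵥ u) = c * (1 - θ) := by
    rw [hEu]
    nth_rw 1 [huχ]
    rw [sub_dotProduct, smul_dotProduct, dotProduct_mulVec 1, hone', hχE]
    simp
  have huu : u ⬝ᵥ u = c * (1 - θ) := by
    rw [hu, shiftedIndicator_dotProduct hθ hY hY, Finset.inter_self, hY]; ring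
  have hEuEu : (E *ᵥ u) ⬝ᵥ (E *ᵥ u) = c * (1 - θ) := by
    rw [dotProduct_mulVec, ← mulVec_transpose, hE.eq, mulVec_mulVec, hEE, dotProduct_comm, huEu]
  refine sub_eq_zero.1 (dotProduct_self_eq_zero.1 ?_)
  rw [sub_dotProduct, dotProduct_sub, dotProduct_sub, hEuEu, huEu, huu, dotProduct_comm, huEu]
  ring

/-- The intersection numbers of a maximal family of sets attaining Hoffman's bound, in terms of
the projection `E` onto the eigenspace of the least eigenvalue. -/
theorem Matrix.IsSymm.inter_card_of_hoffman_family {V ι : Type*} [Fintype V] [DecidableEq V]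
    [Fintype ι] {E : Matrix V V ℚ} (hE : E.IsSymm) (hEE : E * E = E)
    (hone : E *ᵥ 1 = 0) {θ c b : ℚ} (hdiag : ∀ x, E x x = θ)
    (hθ : θ * Fintype.card V = c) (hb : (c - 1) * b = 1 - 2 * θ) (hb0 : b ≠ 0) (hθb : θ ≠ b)
    (hθ1 : θ ≠ 1) {Y : ι → Finset V} (hinj : Function.Injective Y)
    (hι : (Fintype.card ι : ℚ) = c + 1) (hY : ∀ i, ((Y i).card : ℚ) = c)
    (hoff : ∀ i, ∀ y ∈ Y i, ∀ z ∈ Y i, y ≠ z → E y z = b) :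
    (∀ i j, i ≠ j → ((Y i ∩ Y j).card : ℚ) = (c + 1) * θ - 1) ∧
    (∀ x, ((Finset.univ.filter fun i => x ∈ Y i).card : ℚ) = (c + 1) * θ) ∧
    ∀ x y, ((Finset.univ.filter fun i => x ∈ Y i ∧ y ∈ Y i).card : ℚ) =
      (c + 1) * θ ^ 2 + (c + 1) * (1 - θ) * E x y := by
  classical
  have htr : E.trace = c := by
    simp [trace, hdiag, ← hθ, mul_comm]
  have hfix : ∀ i, E *ᵥ shiftedIndicator θ (Y i) = shiftedIndicator θ (Y i) := fun i =>
    hE.mulVec_shiftedIndicator hEE hone hθ hb (hY i) (fun y _ => hdiag y) (hoff i)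
  have hθb' : θ - b ≠ 0 := sub_ne_zero.2 hθb
  have hθ1' : 1 - θ ≠ 0 := sub_ne_zero.2 hθ1.symm
  have hinter : ∀ i j, i ≠ j → ((Y i ∩ Y j).card : ℚ) = (c + 1) * θ - 1 := by
    intro i j hij
    have hne : ((Y i ∩ Y j).card : ℚ) ≠ c := by
      intro hc
      have h1 : (Y i ∩ Y j).card = (Y i).card := by exact_mod_cast hc.trans (hY i).symm
      have h2 : (Y i ∩ Y j).card = (Y j).card := by exact_mod_cast hc.trans (hY j).symm
      have h3 := Finset.eq_of_subset_of_card_le Finset.inter_subset_left h1.ge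
      have h4 := Finset.eq_of_subset_of_card_le Finset.inter_subset_right h2.ge
      exact hij (hinj (h3.symm.trans h4))
    have hα : (θ - b)⁻¹ * (θ - b) = 1 := inv_mul_cancel₀ hθb'
    have hβ : (θ - b)⁻¹ * b + -b * (θ - b)⁻¹ * (1 - θ)⁻¹ * (θ - b)
        + -b * (θ - b)⁻¹ * (1 - θ)⁻¹ * b * (Y i).card = 0 := by
      rw [hY i]
      field_simp
      linear_combination -b * hb
    have hq := hE.dotProduct_self_of_fixed hEE (htr.trans (hY i).symm) (fun y _ => hdiag y)
      (hoff i) hα hβ (hfix j)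
    have hs1 : ∑ y ∈ Y i, shiftedIndicator θ (Y j) y = (Y i ∩ Y j).card - c * θ := by
      simp [shiftedIndicator, Finset.sum_sub_distrib, Finset.sum_ite_mem, hY i]
    have hs2 : ∑ y ∈ Y i, shiftedIndicator θ (Y j) y ^ 2 =
        (Y i ∩ Y j).card * (1 - 2 * θ) + c * θ ^ 2 := by
      have : ∀ y, shiftedIndicator θ (Y j) y ^ 2 =
          (1 - 2 * θ) * (if y ∈ Y j then 1 else 0) + θ ^ 2 := by
        intro y; unfold shiftedIndicator; split_ifs <;> ring
      simp only [this, Finset.sum_add_distrib, ← Finset.mul_sum, Finset.sum_ite_mem,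
        Finset.sum_const, nsmul_eq_mul, mul_one, hY i]
      ring
    rw [shiftedIndicator_dotProduct hθ (hY j) (hY j), Finset.inter_self, hY j, hs1, hs2] at hq
    generalize ((Y i ∩ Y j).card : ℚ) = s at hq hne ⊢
    field_simp at hq
    have hprod : (s - c) * b * ((c + 1) * θ - 1 - s) = 0 := by
      linear_combination -hq + ((s - c) * (1 - θ) + c * (1 - θ) ^ 2) * hb
    rcases mul_eq_zero.1 hprod with h | h
    · rcases mul_eq_zero.1 h with h | h
      · exact absurd (sub_eq_zero.1 h) hne
      · exact absurd h hb0
    · linarith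
  have hdot : ∀ i j, shiftedIndicator θ (Y i) ⬝ᵥ shiftedIndicator θ (Y j) =
      if i = j then c * (1 - θ) else -(1 - θ) := by
    intro i j
    rw [shiftedIndicator_dotProduct hθ (hY i) (hY j)]
    split_ifs with hij
    · rw [hij, Finset.inter_self, hY j]; ring
    · rw [hinter i j hij]; ring
  obtain ⟨hzero, hframe⟩ := hE.simplex_in_range hEE htr hι hfix hdot
  have hpt : ∀ x, ((Finset.univ.filter fun i => x ∈ Y i).card : ℚ) = (c + 1) * θ := by
    intro x
    have := hzero x
    simp only [shiftedIndicator, Finset.sum_sub_distrib, Finset.sum_boole, Finset.sum_const,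
      Finset.card_univ, nsmul_eq_mul, hι] at this
    linarith
  refine ⟨hinter, hpt, fun x y => ?_⟩
  have hexp : ∀ i, shiftedIndicator θ (Y i) x * shiftedIndicator θ (Y i) y =
      (if x ∈ Y i ∧ y ∈ Y i then 1 else 0) - θ * (if x ∈ Y i then 1 else 0)
        - θ * (if y ∈ Y i then 1 else 0) + θ * θ := by
    intro i
    by_cases hx : x ∈ Y i <;> by_cases hx' : y ∈ Y i <;> simp [shiftedIndicator, hx, hx'] <;> ring
  have := hframe x y
  simp only [hexp, Finset.sum_add_distrib, Finset.sum_sub_distrib, ← Finset.mul_sum,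
    Finset.sum_boole, hpt, Finset.sum_const, Finset.card_univ, nsmul_eq_mul, hι] at this
  linear_combination this

/-- Feasibility relations for a strongly regular graph with eigenvalues `k`, `p`, `n` whose ratio
bound `c` equals the multiplicity of `n`. -/
theorem hoffman_eq_cvetkovic_param {v k m c p n : ℚ} (hn : n < 0) (hp : 0 ≤ p) (hk : 0 < k)
    (hv : 0 < v) (hm : 0 < m) (hmk : m = k + p * n) (hvm : v * m = (k - p) * (k - n))
    (hmult : c = v - 1 - (n + 1) * k * (k - n) / (m * (n - p)))
    (hbound : v * n = c * (n - k)) :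
    k * (p + 1) = n * (n - p) ∧ m * (p + 1) = n * (n + p ^ 2) ∧
      v * (p + 1) = c * (2 * p + 1 - n) ∧
      c * (n + p ^ 2) = p ^ 2 + p + n * p - n ^ 2 := by
  have hnp : n - p ≠ 0 := by linarith
  have hkn : k - n ≠ 0 := by linarith
  have hkp : k - p ≠ 0 := by
    intro h
    rw [h, zero_mul] at hvm
    exact (mul_pos hv hm).ne' hvm
  have hcm : c * m = -n * (k - p) := by
    apply mul_right_cancel₀ hkn
    linear_combination m * hbound - n * hvm
  have hk1 : k * (p + 1) = n * (n - p) := by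
    field_simp at hmult
    have h0 : (k - p) * (k * (p + 1) - n * (n - p)) = 0 := by
      linear_combination hmult - (n - p) * hcm + (n - p) * hvm - (n - p) * hmk
    exact sub_eq_zero.1 ((mul_eq_zero.1 h0).resolve_left hkp)
  have hm1 : m * (p + 1) = n * (n + p ^ 2) := by
    rw [hmk]; linear_combination hk1
  refine ⟨hk1, hm1, ?_, ?_⟩
  · apply mul_right_cancel₀ hn.ne
    linear_combination (p + 1) * hbound - c * hk1
  · apply mul_right_cancel₀ hn.ne
    linear_combination (p + 1) * hcm - c * hm1 - n * hk1

end

theorem srg_max_number_of_delsarte_cocliques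
    {V : Type*} [Fintype V] [DecidableEq V] (G : SimpleGraph V) [DecidableRel G.Adj]
    (v k l m : ℕ) (eP eN : ℤ) (mN : ℕ)
    (hsrg : G.IsSRGWith v k l m)
    (hconn : G.Connected) (hconnCompl : Gᶜ.Connected)
    (heP : 0 ≤ eP) (heN : eN < 0)
    (hProot : eP ^ 2 - ((l : ℤ) - (m : ℤ)) * eP - ((k : ℤ) - (m : ℤ)) = 0)
    (hNroot : eN ^ 2 - ((l : ℤ) - (m : ℤ)) * eN - ((k : ℤ) - (m : ℤ)) = 0)
    (hmult : (mN : ℚ) = (v : ℚ) - 1 -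
      ((eN : ℚ) + 1) * (k : ℚ) * ((k : ℚ) - (eN : ℚ)) / ((m : ℚ) * ((eN : ℚ) - (eP : ℚ))))
    (hbound : (v : ℤ) * eN = (mN : ℤ) * (eN - (k : ℤ)))
    (Y : Fin (mN + 1) → Finset V) (hinj : Function.Injective Y)
    (hdel : ∀ i, IsDelsarteCoclique G v k eN (Y i))
    (hall : ∀ W : Finset V, IsDelsarteCoclique G v k eN W → ∃ i, W = Y i) :
    -- every vertex of Γ lies in exactly 1 + (e⁻+1)e⁺/((e⁺)²+e⁻) of the cocliques
    (∀ x : V, ((Finset.univ.filter (fun i => x ∈ Y i)).card : ℚ)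
        = 1 + ((eN : ℚ) + 1) * (eP : ℚ) / ((eP : ℚ) ^ 2 + (eN : ℚ))) ∧
    -- the sets Y 0 ∩ Y i (i ≠ 0) form a symmetric 2-design on the mN points of Y 0:
    ((Y 0).card = mN) ∧
    -- each block Y 0 ∩ Y i has size (e⁻+1)e⁺/((e⁺)²+e⁻)
    (∀ i, i ≠ 0 → (((Y 0 ∩ Y i).card : ℚ)
        = ((eN : ℚ) + 1) * (eP : ℚ) / ((eP : ℚ) ^ 2 + (eN : ℚ)))) ∧
    -- every point of Y 0 lies in exactly (e⁻+1)e⁺/((e⁺)²+e⁻) of the blocks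
    (∀ y ∈ Y 0, ((Finset.univ.filter (fun i => i ≠ 0 ∧ y ∈ Y i)).card : ℚ)
        = ((eN : ℚ) + 1) * (eP : ℚ) / ((eP : ℚ) ^ 2 + (eN : ℚ))) ∧
    -- every pair of distinct points of Y 0 lies in exactly (-(e⁺)²+e⁺)/((e⁺)²+e⁻) blocks
    (∀ y₁ ∈ Y 0, ∀ y₂ ∈ Y 0, y₁ ≠ y₂ →
      ((Finset.univ.filter (fun i => i ≠ 0 ∧ y₁ ∈ Y i ∧ y₂ ∈ Y i)).card : ℚ)
        = (-(eP : ℚ) ^ 2 + (eP : ℚ)) / ((eP : ℚ) ^ 2 + (eN : ℚ))) := by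
  have hne : Nonempty V := hconn.nonempty
  have hv : (0 : ℚ) < v := by
    rw [← hsrg.card]; exact_mod_cast Fintype.card_pos
  have hPN : eP - eN ≠ 0 := by omega
  have hsumZ : eP + eN = (l : ℤ) - m :=
    mul_left_cancel₀ hPN (by linear_combination hProot - hNroot)
  have hprodZ : eP * eN = (m : ℤ) - k := by
    linear_combination eP * hsumZ - hProot
  have hk0 : k ≠ 0 := by
    rintro rfl
    have h1 : eP * eN ≤ 0 := mul_nonpos_of_nonneg_of_nonpos heP heN.le
    have hm0 : m = 0 := by push_cast at hprodZ; omega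
    subst hm0
    have h2 : eP = 0 := by
      simpa [heN.ne] using hprodZ
    subst h2
    push_cast at hsumZ
    omega
  have hm0 : m ≠ 0 := hsrg.mu_ne_zero_s5 hconn hconnCompl hk0
  have hmk : m ≠ k := hsrg.mu_ne_degree hconnCompl hk0
  have hP1 : 1 ≤ eP := by
    rcases heP.lt_or_eq with h | h
    · omega
    · rw [← h] at hprodZ; omega
  have hsum : (eP : ℚ) + eN = l - m := by exact_mod_cast hsumZ
  have hprod : (eP : ℚ) * eN = m - k := by exact_mod_cast hprodZ
  have hbound' : (v : ℚ) * eN = mN * (eN - k) := by exact_mod_cast hbound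
  have hn : (eN : ℚ) < 0 := by exact_mod_cast heN
  have hp : (1 : ℚ) ≤ eP := by exact_mod_cast hP1
  have hk : (0 : ℚ) < k := by exact_mod_cast Nat.pos_of_ne_zero hk0
  have hm : (0 : ℚ) < m := by exact_mod_cast Nat.pos_of_ne_zero hm0
  have hcard : ∀ i, ((Y i).card : ℚ) = mN := by
    intro i
    have h : ((Y i).card : ℚ) * (eN - k) = v * eN := by exact_mod_cast (hdel i).2
    have hne : (eN : ℚ) - k ≠ 0 := by linarith
    exact mul_right_cancel₀ hne (h.trans hbound')
  generalize (eP : ℚ) = p at *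
  generalize (eN : ℚ) = n at *
  have hvm : (v : ℚ) * m = (k - p) * (k - n) := by
    linear_combination -hsrg.param_eq_rat + k * hsum - hprod
  obtain ⟨hk1, hm1, hv1, hc1⟩ := hoffman_eq_cvetkovic_param hn (by linarith) hk hv hm
    (by linarith) hvm hmult hbound'
  have hnp2 : n + p ^ 2 < 0 := by
    by_contra! h
    have : m * (p + 1) ≤ (0 : ℚ) := hm1 ▸ mul_nonpos_of_nonpos_of_nonneg hn.le h
    nlinarith
  obtain ⟨d, hd⟩ : ∃ d, d = 2 * p + 1 - n := ⟨_, rfl⟩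
  have hr : d ≠ 0 := by rw [hd]; linarith
  have hnp : n - p ≠ 0 := by linarith
  have hpn : p - n ≠ 0 := by linarith
  have hs : p ^ 2 + n ≠ 0 := by linarith
  have hs' : n + p ^ 2 ≠ 0 := hnp2.ne
  have hc : (mN : ℚ) = (p ^ 2 + p + n * p - n ^ 2) / (n + p ^ 2) := by
    rw [eq_div_iff hs', hc1]
  set t : ℚ := -(n + p ^ 2) / d with ht
  have htv : t * v = k - p := by
    rw [ht, div_mul_eq_mul_div, div_eq_iff hr, hd]
    apply mul_right_cancel₀ hn.ne
    linear_combination v * hm1 - (p + 1) * hvm - (k - p) * hk1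
  set θ : ℚ := (p + 1) / d with hθdef
  set b : ℚ := (n - p)⁻¹ * (-t) with hbdef
  have hθ : θ * Fintype.card V = mN := by
    rw [hsrg.card, hθdef, div_mul_eq_mul_div, div_eq_iff hr, hd]; linarith
  have hdiagθ : (n - p)⁻¹ * (-p - t) = θ := by
    rw [ht, hθdef]; field_simp; rw [hd]; ring
  have hb : ((mN : ℚ) - 1) * b = 1 - 2 * θ := by
    rw [hc, hbdef, ht, hθdef]; field_simp; rw [hd]; ring
  have hb0 : b ≠ 0 :=
    mul_ne_zero (inv_ne_zero hnp) (neg_ne_zero.2 (div_ne_zero (neg_ne_zero.2 hs') hr))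
  have hθb : θ ≠ b := by
    rw [← hdiagθ, hbdef, Ne, mul_right_inj' (inv_ne_zero hnp)]
    intro h; linarith
  have hθ1 : θ ≠ 1 := by
    rw [hθdef, Ne, div_eq_one_iff_eq hr]
    intro h; linarith
  have hoffE : ∀ i, ∀ y ∈ Y i, ∀ z ∈ Y i, y ≠ z → G.eigenProj p n t y z = b :=
    fun i y hy z hz hyz =>
      SimpleGraph.eigenProj_apply_of_not_adj p n t hyz ((hdel i).1 y hy z hz)
  obtain ⟨hblock, hpoint, hpair⟩ :=
    (SimpleGraph.eigenProj_isSymm (G := G) p n t).inter_card_of_hoffman_family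
      (hsrg.eigenProj_mul_self hsum hprod (sub_ne_zero.1 hnp) htv)
      (hsrg.eigenProj_mulVec_one htv)
      (fun x => (SimpleGraph.eigenProj_apply_self p n t x).trans hdiagθ)
      hθ hb hb0 hθb hθ1 hinj (by simp) hcard hoffE
  have hrep : ((mN : ℚ) + 1) * θ = 1 + (n + 1) * p / (p ^ 2 + n) := by
    rw [hc, hθdef, add_comm (p ^ 2) n]; field_simp; rw [hd]; ring
  have herase : ∀ (q : Fin (mN + 1) → Prop) [DecidablePred q], q 0 →
      ((Finset.univ.filter fun i => i ≠ 0 ∧ q i).card : ℚ) =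
        (Finset.univ.filter q).card - 1 := by
    intro q _ hq
    have h0 : (0 : Fin (mN + 1)) ∈ Finset.univ.filter q := by simpa using hq
    have : (Finset.univ.filter fun i => i ≠ 0 ∧ q i) = (Finset.univ.filter q).erase 0 := by
      ext i; simp
    rw [this, Finset.card_erase_of_mem h0, Nat.cast_sub (Finset.card_pos.2 ⟨0, h0⟩), Nat.cast_one]
  refine ⟨fun x => ?_, by exact_mod_cast hcard 0, fun i hi => ?_, fun y hy => ?_,
    fun y hy z hz hyz => ?_⟩
  · convert (hpoint x).trans hrep
  · rw [hblock 0 i hi.symm, hrep]; ring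
  · have h := herase (fun i => y ∈ Y i) hy
    rw [hpoint, hrep, add_sub_cancel_left] at h
    convert h
  · have h := herase (fun i => y ∈ Y i ∧ z ∈ Y i) ⟨hy, hz⟩
    rw [hpair, hoffE 0 y hy z hz hyz] at h
    have hfin : ((mN : ℚ) + 1) * θ ^ 2 + ((mN : ℚ) + 1) * (1 - θ) * b - 1 =
        (-p ^ 2 + p) / (p ^ 2 + n) := by
      rw [hc, hθdef, hbdef, ht, add_comm (p ^ 2) n]; field_simp; rw [hd]; ring
    rw [hfin] at h
    convert h
end

section
/- Let Γ be a primitive strongly regular graph with eigenvalues k, e⁺, e⁻ (multiplicity m⁻ of e⁻) satisfying v·e⁻ = m⁻(e⁻ − k). Then any three pairwise distinct Delsarte cocliques Y₁, Y₂, Y₃ of Γ satisfy |Y₁ ∩ Y₂ ∩ Y₃| = (−(e⁺)² + e⁺)/((e⁺)² + e⁻). -/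
open Matrix in
/-- The adjacency matrix of a strongly regular graph satisfies a quadratic equation
modulo the all-ones matrix. -/
theorem SimpleGraph.IsSRGWith.adjMatrix_mulVec_mulVec {V : Type*} [Fintype V] [DecidableEq V]
    {G : SimpleGraph V} [DecidableRel G.Adj] {v k l m : ℕ} (h : G.IsSRGWith v k l m)
    (u : V → ℤ) :
    G.adjMatrix ℤ *ᵥ (G.adjMatrix ℤ *ᵥ u) =
      ((l : ℤ) - m) • (G.adjMatrix ℤ *ᵥ u) + ((k : ℤ) - m) • u + ((m : ℤ) * (u ⬝ᵥ 1)) • 1 := by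
  have hJ : G.adjMatrix ℤ + Gᶜ.adjMatrix ℤ + 1 = Matrix.of fun _ _ => (1 : ℤ) := by
    ext x y
    by_cases hxy : x = y
    · simp [hxy]
    · by_cases hadj : G.Adj x y <;> simp [SimpleGraph.adjMatrix_apply, hxy, hadj]
  have hJu : (Matrix.of fun _ _ => (1 : ℤ)) *ᵥ u = (u ⬝ᵥ 1) • (1 : V → ℤ) := by
    ext x
    simp [Matrix.mulVec, dotProduct]
  have hc : Gᶜ.adjMatrix ℤ *ᵥ u = (u ⬝ᵥ 1) • (1 : V → ℤ) - u - G.adjMatrix ℤ *ᵥ u := by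
    rw [← hJu, ← hJ]
    simp only [Matrix.add_mulVec, Matrix.one_mulVec]
    abel
  rw [Matrix.mulVec_mulVec, ← pow_two, h.matrix_eq (α := ℤ)]
  simp only [Matrix.add_mulVec, Matrix.smul_mulVec, Matrix.one_mulVec, hc]
  ext x
  simp
  ring

/-- The integer-valued characteristic vector of a finite set. -/
def Finset.charVec {V : Type*} [DecidableEq V] (Y : Finset V) : V → ℤ :=
  fun x => if x ∈ Y then 1 else 0

theorem Finset.charVec_mul {V : Type*} [DecidableEq V] (Y Z : Finset V) :
    Y.charVec * Z.charVec = (Y ∩ Z).charVec := by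
  ext x
  by_cases hy : x ∈ Y <;> by_cases hz : x ∈ Z <;> simp [Finset.charVec, hy, hz]

open Matrix in
theorem SimpleGraph.dotProduct_adjMatrix_mulVec {V : Type*} [Fintype V]
    (G : SimpleGraph V) [DecidableRel G.Adj] (u w : V → ℤ) :
    u ⬝ᵥ (G.adjMatrix ℤ *ᵥ w) = (G.adjMatrix ℤ *ᵥ u) ⬝ᵥ w := by
  rw [Matrix.dotProduct_mulVec, ← Matrix.mulVec_transpose, SimpleGraph.transpose_adjMatrix]

open Matrix in
theorem SimpleGraph.IsSRGWith.adjMatrix_mulVec_one {V : Type*} [Fintype V]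
    {G : SimpleGraph V} [DecidableRel G.Adj] {v k l m : ℕ} (h : G.IsSRGWith v k l m) :
    G.adjMatrix ℤ *ᵥ 1 = (k : ℤ) • (1 : V → ℤ) := by
  ext x
  simp [Pi.one_def, h.regular.degree_eq x]

section charVec

open Matrix

variable {V : Type*} [Fintype V] [DecidableEq V]

theorem Finset.charVec_dotProduct (Y Z : Finset V) :
    Y.charVec ⬝ᵥ Z.charVec = ((Y ∩ Z).card : ℤ) := by
  have h : Y.charVec ⬝ᵥ Z.charVec = ∑ x, (Y.charVec * Z.charVec) x := rfl
  rw [h, Finset.charVec_mul]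
  simp only [Finset.charVec, Finset.sum_boole, Finset.filter_univ_mem]

theorem Finset.charVec_dotProduct_one (Y : Finset V) : Y.charVec ⬝ᵥ 1 = (Y.card : ℤ) := by
  simp [Finset.charVec, dotProduct]

theorem Finset.mul_charVec_dotProduct (Y : Finset V) (p u : V → ℤ) :
    (Y.charVec * p) ⬝ᵥ u = p ⬝ᵥ (Y.charVec * u) := by
  simp only [dotProduct, Pi.mul_apply]
  exact Finset.sum_congr rfl fun x _ => by ring

theorem IsCoclique.charVec_mul_adjMatrix_mulVec {G : SimpleGraph V} [DecidableRel G.Adj]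
    {Y : Finset V} (hY : IsCoclique G Y) (p : V → ℤ) :
    Y.charVec * (G.adjMatrix ℤ *ᵥ (Y.charVec * p)) = 0 := by
  ext x
  by_cases hx : x ∈ Y
  · simp only [Pi.mul_apply, Matrix.mulVec, dotProduct, Pi.zero_apply]
    rw [Finset.sum_eq_zero, mul_zero]
    intro y _
    by_cases hy : y ∈ Y
    · rw [SimpleGraph.adjMatrix_apply, if_neg (hY x hx y hy), zero_mul]
    · simp [Finset.charVec, hy]
  · simp [Finset.charVec, hx]

end charVec

section delsarte

open Matrix

variable {V : Type*} [Fintype V] [DecidableEq V] {G : SimpleGraph V} [DecidableRel G.Adj]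
  {v k l m : ℕ} {r s : ℤ}

/-- Every vertex outside a Delsarte coclique has exactly `-s` neighbours in it. -/
theorem IsDelsarteCoclique.adjMatrix_mulVec_charVec (h : G.IsSRGWith v k l m)
    (hlm : (l : ℤ) - m = r + s) (hkm : (k : ℤ) - m = -(r * s))
    {Y : Finset V} (hY : IsDelsarteCoclique G v k s Y)
    (hc : (Y.card : ℤ) * m = -(k - r) * s) :
    G.adjMatrix ℤ *ᵥ Y.charVec = -s • (1 - Y.charVec) := by
  have hsq := h.adjMatrix_mulVec_mulVec
  rw [hlm, hkm] at hsq
  have hA1 := h.adjMatrix_mulVec_one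
  set A := G.adjMatrix ℤ
  set χ := Y.charVec with hχ
  have h0 : χ ⬝ᵥ (A *ᵥ χ) = 0 := by
    have := hY.1.charVec_mul_adjMatrix_mulVec 1
    have h2 := Finset.mul_charVec_dotProduct Y 1 (A *ᵥ χ)
    rw [mul_one] at this h2
    rw [h2, this, dotProduct_zero]
  have h1 : χ ⬝ᵥ 1 = (Y.card : ℤ) := Y.charVec_dotProduct_one
  have h1' : 1 ⬝ᵥ χ = (Y.card : ℤ) := by rw [dotProduct_comm, h1]
  have h2 : χ ⬝ᵥ χ = (Y.card : ℤ) := by rw [hχ, Finset.charVec_dotProduct, Finset.inter_self]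
  have h3 : (1 : V → ℤ) ⬝ᵥ 1 = v := by simp [dotProduct, h.card]
  have h4 : (A *ᵥ χ) ⬝ᵥ 1 = (k : ℤ) * Y.card := by
    rw [← SimpleGraph.dotProduct_adjMatrix_mulVec, hA1, dotProduct_smul, h1,
      smul_eq_mul]
  have h4' : 1 ⬝ᵥ (A *ᵥ χ) = (k : ℤ) * Y.card := by rw [dotProduct_comm, h4]
  have h0' : (A *ᵥ χ) ⬝ᵥ χ = 0 := by rw [dotProduct_comm, h0]
  have h5 : (A *ᵥ χ) ⬝ᵥ (A *ᵥ χ) = -(r * s) * Y.card + m * Y.card ^ 2 := by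
    rw [← SimpleGraph.dotProduct_adjMatrix_mulVec, hsq]
    simp only [dotProduct_add, dotProduct_smul, h0, h1, h2, smul_eq_mul]
    ring
  have key : A *ᵥ χ + s • (1 - χ) = 0 := by
    rw [← dotProduct_self_eq_zero]
    simp only [dotProduct_add, add_dotProduct, dotProduct_smul, smul_dotProduct, dotProduct_sub,
      sub_dotProduct, h0, h0', h1, h1', h2, h3, h4, h4', h5, smul_eq_mul]
    have := hY.2
    linear_combination (Y.card : ℤ) * hc - s * this
  rw [neg_smul]
  exact eq_neg_of_add_eq_zero_left key

/-- When Hoffman's and Cvetković's bounds agree, the number of common neighbours inside a Delsarte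
coclique of two vertices outside it depends only on whether they are equal or adjacent. -/
theorem IsDelsarteCoclique.adjMatrix_mulVec_charVec_mul (h : G.IsSRGWith v k l m)
    (hlm : (l : ℤ) - m = r + s) (hkm : (k : ℤ) - m = -(r * s)) (hm : 0 < m) (hr : 0 ≤ r)
    (hv : (v : ℤ) * m = (k - r) * (k - s)) (hk : (k : ℤ) * (1 + r) = s * (s - r))
    {Y : Finset V} (hY : IsDelsarteCoclique G v k s Y)
    (hc : (Y.card : ℤ) * m = -(k - r) * s) {w : V} (hw : w ∉ Y) :
    G.adjMatrix ℤ *ᵥ (Y.charVec * (G.adjMatrix ℤ *ᵥ Pi.single w 1))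
      + r • (G.adjMatrix ℤ *ᵥ Pi.single w 1 - Y.charVec * (G.adjMatrix ℤ *ᵥ Pi.single w 1))
      - r ^ 2 • Pi.single w 1 + (s + r ^ 2) • (1 - Y.charVec) = 0 := by
  have hYA := hY.adjMatrix_mulVec_charVec h hlm hkm hc
  have hsq := h.adjMatrix_mulVec_mulVec
  rw [hlm, hkm] at hsq
  have hA1 := h.adjMatrix_mulVec_one
  set A := G.adjMatrix ℤ
  set χ := Y.charVec with hχ
  set e : V → ℤ := Pi.single w 1 with he
  set p := A *ᵥ e with hp
  set q := χ * p with hq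
  set n := A *ᵥ q with hn
  have hχw : χ w = 0 := by simp [hχ, Finset.charVec, hw]
  have hχχ : χ * χ = χ := by rw [hχ, Finset.charVec_mul, Finset.inter_self]
  have hpp : p * p = p := by
    ext x
    by_cases hx : G.Adj x w <;> simp [hp, he, A, SimpleGraph.adjMatrix_apply, hx]
  have hpw : p w = 0 := by simp [hp, he, A]
  have ee : e ⬝ᵥ e = 1 := by simp [he]
  have e1 : e ⬝ᵥ 1 = 1 := by simp [he]
  have eχ : e ⬝ᵥ χ = 0 := by simp [he, hχw]
  have pe : p ⬝ᵥ e = 0 := by simp [he, hpw]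
  have pχ : p ⬝ᵥ χ = -s := by
    rw [hp, ← SimpleGraph.dotProduct_adjMatrix_mulVec, hYA]
    simp only [dotProduct_smul, dotProduct_sub, e1, eχ]
    simp
  have p1 : p ⬝ᵥ 1 = k := by
    rw [hp, ← SimpleGraph.dotProduct_adjMatrix_mulVec, hA1, dotProduct_smul, e1]
    simp
  have sum_mul (a b : V → ℤ) : a ⬝ᵥ b = (a * b) ⬝ᵥ 1 := by simp [dotProduct]
  have pp : p ⬝ᵥ p = k := by rw [sum_mul, hpp, p1]
  have q1 : q ⬝ᵥ 1 = -s := by rw [hq, Finset.mul_charVec_dotProduct, mul_one, pχ]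
  have qχ : q ⬝ᵥ χ = -s := by rw [hq, Finset.mul_charVec_dotProduct, hχχ, pχ]
  have qp : q ⬝ᵥ p = -s := by rw [sum_mul, hq, mul_assoc, hpp, ← hq, q1]
  have qq : q ⬝ᵥ q = -s := by
    rw [sum_mul, hq, mul_mul_mul_comm, hpp, hχχ, ← hq, q1]
  have qe : q ⬝ᵥ e = 0 := by simp [he, hq, hpw]
  have χn : χ * n = 0 := hY.1.charVec_mul_adjMatrix_mulVec p
  have nq : n ⬝ᵥ q = 0 := by
    rw [dotProduct_comm, hq, Finset.mul_charVec_dotProduct, χn, dotProduct_zero]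
  have nχ : n ⬝ᵥ χ = 0 := by rw [sum_mul, mul_comm, χn, zero_dotProduct]
  have nn : n ⬝ᵥ n = r * s ^ 2 + m * s ^ 2 := by
    rw [hn, ← SimpleGraph.dotProduct_adjMatrix_mulVec, hsq]
    simp only [dotProduct_add, dotProduct_smul, ← hn, dotProduct_comm q n, nq, qq, q1, smul_eq_mul]
    ring
  have np : n ⬝ᵥ p = -(r + s) * s - m * s := by
    rw [hn, ← SimpleGraph.dotProduct_adjMatrix_mulVec, hp, hsq]
    simp only [dotProduct_add, dotProduct_smul, ← hp, qp, qe, e1, q1, smul_eq_mul]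
    ring
  have ne : n ⬝ᵥ e = -s := by
    rw [hn, ← SimpleGraph.dotProduct_adjMatrix_mulVec, ← hp, qp]
  have n1 : n ⬝ᵥ 1 = -s * k := by
    rw [hn, ← SimpleGraph.dotProduct_adjMatrix_mulVec, hA1, dotProduct_smul, q1,
      smul_eq_mul, mul_comm]
  have o1 : (1 : V → ℤ) ⬝ᵥ 1 = v := by simp [dotProduct, h.card]
  have χ1 : χ ⬝ᵥ 1 = (Y.card : ℤ) := Y.charVec_dotProduct_one
  have χχ : χ ⬝ᵥ χ = (Y.card : ℤ) := by rw [sum_mul, hχχ, χ1]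
  rw [← dotProduct_self_eq_zero]
  simp only [dotProduct_add, add_dotProduct, dotProduct_smul, smul_dotProduct, dotProduct_sub,
    sub_dotProduct, smul_eq_mul,
    dotProduct_comm 1, dotProduct_comm e p, dotProduct_comm e q, dotProduct_comm e n,
    dotProduct_comm χ e, dotProduct_comm χ p, dotProduct_comm χ q, dotProduct_comm χ n,
    dotProduct_comm p q, dotProduct_comm p n, dotProduct_comm q n,
    ee, e1, eχ, pe, pχ, p1, pp, q1, qχ, qp, qq, qe, nq, nχ, nn, np, ne, n1, χ1, χχ]
  simp only [o1]
  have hμ : (m : ℤ) = k + r * s := by linarith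
  have hne : (m : ℤ) * (1 + r) ^ 2 ≠ 0 := by positivity
  have hvc : ((v : ℤ) - Y.card) * m = (k - r) * k := by linear_combination hv - hc
  refine (mul_eq_zero.mp ?_).resolve_left hne
  set D := s + r ^ 2 with hD
  set K₁ := s ^ 2 + r ^ 2 - 2 * r * s - 2 * D * s + 2 * r * D with hK₁
  set K₀ := r * s ^ 2 + r * s ^ 3 + r ^ 2 * s + r ^ 4 - 2 * r * s ^ 2 - 2 * r ^ 2 * s ^ 2
    + 2 * r * D * s - 2 * r ^ 2 * D with hK₀
  linear_combination (m : ℤ) * (1 + r) ^ 2 * (s ^ 2 - 2 * r * s) * hμ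
    + (1 + r) ^ 2 * (K₁ * k + K₀) * hμ + (1 + r) ^ 2 * D ^ 2 * hvc
    + ((K₁ + D ^ 2) * (k * (1 + r) + s * (s - r))
      + (K₁ * (r * s) + K₀ - D ^ 2 * r) * (1 + r)) * hk

/-- A vertex outside two distinct Delsarte cocliques has exactly `r` neighbours in their
intersection, and the size of the intersection is determined by the parameters. -/
theorem IsDelsarteCoclique.pair_intersection (h : G.IsSRGWith v k l m)
    (hlm : (l : ℤ) - m = r + s) (hkm : (k : ℤ) - m = -(r * s)) (hm : 0 < m) (hr : 0 ≤ r)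
    (hs : s < 0)
    (hv : (v : ℤ) * m = (k - r) * (k - s)) (hk : (k : ℤ) * (1 + r) = s * (s - r))
    {Y Z : Finset V} (hY : IsDelsarteCoclique G v k s Y) (hZ : IsDelsarteCoclique G v k s Z)
    {c : ℤ} (hYc : (Y.card : ℤ) = c) (hZc : (Z.card : ℤ) = c) (hc : c * m = -(k - r) * s)
    (hYZ : Y ≠ Z) :
    G.adjMatrix ℤ *ᵥ (Y.charVec * Z.charVec) = r • ((1 - Y.charVec) * (1 - Z.charVec)) ∧
      (s + r ^ 2) * (c - ((Y ∩ Z).card : ℤ)) = r ^ 2 - s ^ 2 := by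
  have hYA := hY.adjMatrix_mulVec_charVec h hlm hkm (by rw [hYc, hc])
  have hZA := hZ.adjMatrix_mulVec_charVec h hlm hkm (by rw [hZc, hc])
  have hrow (u : V → ℤ) (w : V) :
      (G.adjMatrix ℤ *ᵥ Pi.single w 1) ⬝ᵥ u = (G.adjMatrix ℤ *ᵥ u) w := by
    rw [← SimpleGraph.dotProduct_adjMatrix_mulVec, single_one_dotProduct]
  have hrel (w : V) (hw : w ∉ Y) :
      -s * (-s - (G.adjMatrix ℤ *ᵥ (Y.charVec * Z.charVec)) w)
        + r * (-s * (1 - Z.charVec w) - (G.adjMatrix ℤ *ᵥ (Y.charVec * Z.charVec)) w)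
        - r ^ 2 * Z.charVec w + (s + r ^ 2) * (c - ((Y ∩ Z).card : ℤ)) = 0 := by
    have hf := hY.adjMatrix_mulVec_charVec_mul h hlm hkm hm hr hv hk (by rw [hYc, hc]) hw
    have hf2 := congrArg (· ⬝ᵥ Z.charVec) hf
    have hone : (1 : V → ℤ) ⬝ᵥ Z.charVec = c := by
      rw [dotProduct_comm, Finset.charVec_dotProduct_one, hZc]
    simp only [add_dotProduct, sub_dotProduct, smul_dotProduct, zero_dotProduct,
      ← SimpleGraph.dotProduct_adjMatrix_mulVec _ (Y.charVec * _) Z.charVec, hZA,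
      dotProduct_smul, dotProduct_sub, Finset.mul_charVec_dotProduct, mul_one, hrow, hYA,
      Finset.charVec_dotProduct, hone, single_one_dotProduct, smul_eq_mul, Pi.smul_apply,
      Pi.sub_apply, Pi.one_apply] at hf2
    have hYw : Y.charVec w = 0 := by simp [Finset.charVec, hw]
    rw [hYw] at hf2
    linear_combination hf2
  have hzeroY (w : V) (hw : w ∈ Y) : (G.adjMatrix ℤ *ᵥ (Y.charVec * Z.charVec)) w = 0 := by
    simpa [Finset.charVec, hw] using congrFun (hY.1.charVec_mul_adjMatrix_mulVec Z.charVec) w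
  have hzeroZ (w : V) (hw : w ∈ Z) : (G.adjMatrix ℤ *ᵥ (Y.charVec * Z.charVec)) w = 0 := by
    rw [mul_comm]
    simpa [Finset.charVec, hw] using congrFun (hZ.1.charVec_mul_adjMatrix_mulVec Y.charVec) w
  have hcard : (s + r ^ 2) * (c - ((Y ∩ Z).card : ℤ)) = r ^ 2 - s ^ 2 := by
    obtain ⟨w, hwZ, hwY⟩ : ∃ w ∈ Z, w ∉ Y := by
      by_contra! hsub
      exact hYZ (Finset.eq_of_subset_of_card_le hsub (by lia)).symm
    have := hrel w hwY
    rw [hzeroZ w hwZ, show Z.charVec w = 1 by simp [Finset.charVec, hwZ]] at this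
    linear_combination this
  refine ⟨?_, hcard⟩
  ext w
  by_cases hwY : w ∈ Y
  · rw [hzeroY w hwY]
    simp [Finset.charVec, hwY]
  by_cases hwZ : w ∈ Z
  · rw [hzeroZ w hwZ]
    simp [Finset.charVec, hwZ]
  have hYw : Y.charVec w = 0 := by simp [Finset.charVec, hwY]
  have hZw : Z.charVec w = 0 := by simp [Finset.charVec, hwZ]
  have := hrel w hwY
  simp only [Pi.smul_apply, Pi.mul_apply, Pi.sub_apply, Pi.one_apply, hYw, hZw, smul_eq_mul]
    at this ⊢
  have hsr : s - r ≠ 0 := by lia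
  apply mul_left_cancel₀ hsr
  linear_combination this - hcard

/-- The parameters of a primitive strongly regular graph for which Hoffman's and Cvetković's
bounds agree, in terms of its eigenvalues. -/
theorem SimpleGraph.IsSRGWith.parameters_of_bounds_eq [Nontrivial V] (h : G.IsSRGWith v k l m)
    (hconn : G.Connected) (hconnCompl : Gᶜ.Connected) {mN : ℕ} (hr : 0 ≤ r) (hs : s < 0)
    (hlm : (l : ℤ) - m = r + s) (hkm : (k : ℤ) - m = -(r * s))
    (hmult : (mN : ℚ) = (v : ℚ) - 1 -
      ((s : ℚ) + 1) * (k : ℚ) * ((k : ℚ) - (s : ℚ)) / ((m : ℚ) * ((s : ℚ) - (r : ℚ))))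
    (hbound : (v : ℤ) * s = (mN : ℤ) * (s - (k : ℤ))) :
    0 < m ∧ (v : ℤ) * m = (k - r) * (k - s) ∧ (k : ℤ) * (1 + r) = s * (s - r) ∧
      (mN : ℤ) * m = -(k - r) * s := by
  obtain ⟨x⟩ := hconn.nonempty
  have hk0 : 0 < k := by
    rw [← h.regular.degree_eq x]
    exact hconn.preconnected.degree_pos_of_nontrivial x
  have hkv : 0 < v - k - 1 := by
    have hd := h.compl.regular.degree_eq x
    have := hconnCompl.preconnected.degree_pos_of_nontrivial x
    lia
  have hm : 0 < m := by
    by_contra hm0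
    obtain rfl : m = 0 := by lia
    have hN : (mN : ℤ) = v - 1 := by
      have : (mN : ℚ) = v - 1 := by simpa using hmult
      exact_mod_cast this
    have h1 : s = -(k * (v - 1)) := by
      rw [hN] at hbound
      linear_combination hbound
    have h2 : r * ((v : ℤ) - 1) = 1 := by
      have hkne : (k : ℤ) ≠ 0 := by lia
      apply mul_left_cancel₀ hkne
      rw [h1] at hkm
      push_cast at hkm
      linear_combination -hkm
    have := Int.eq_one_or_neg_one_of_mul_eq_one' h2
    lia
  have hv : (v : ℤ) * m = (k - r) * (k - s) := by
    have hone := congrFun (h.adjMatrix_mulVec_mulVec 1) x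
    rw [h.adjMatrix_mulVec_one, mulVec_smul, h.adjMatrix_mulVec_one] at hone
    simp [dotProduct, h.card] at hone
    linear_combination -hone - (k : ℤ) * hlm - hkm
  have hN : (mN : ℤ) * m * (s - r) = (v - 1) * m * (s - r) - (s + 1) * k * (k - s) := by
    have hmQ : (m : ℚ) ≠ 0 := by positivity
    have hsrQ : (s : ℚ) - r ≠ 0 := by
      have : s - r ≠ 0 := by lia
      exact_mod_cast this
    field_simp at hmult
    have : (mN : ℚ) * m * (s - r) = (v - 1) * m * (s - r) - (s + 1) * k * (k - s) := by
      linear_combination hmult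
    exact_mod_cast this
  have hc : (mN : ℤ) * m = -(k - r) * s := by
    have : s - (k : ℤ) ≠ 0 := by lia
    apply mul_right_cancel₀ this
    linear_combination s * hv - (m : ℤ) * hbound
  have hkr : (k : ℤ) - r ≠ 0 := by
    have : r ≤ -(r * s) := by nlinarith
    lia
  refine ⟨hm, hv, ?_, hc⟩
  apply mul_left_cancel₀ hkr
  linear_combination hN - (s - r) * hc + (s - r) * hv + (s - r) * hkm

end delsarte

open Matrix in
theorem srg_three_delsarte_cocliques_intersection
    {V : Type*} [Fintype V] [DecidableEq V] (G : SimpleGraph V) [DecidableRel G.Adj]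
    (v k l m : ℕ) (eP eN : ℤ) (mN : ℕ)
    (hsrg : G.IsSRGWith v k l m)
    (hconn : G.Connected) (hconnCompl : Gᶜ.Connected)
    (heP : 0 ≤ eP) (heN : eN < 0)
    (hProot : eP ^ 2 - ((l : ℤ) - (m : ℤ)) * eP - ((k : ℤ) - (m : ℤ)) = 0)
    (hNroot : eN ^ 2 - ((l : ℤ) - (m : ℤ)) * eN - ((k : ℤ) - (m : ℤ)) = 0)
    (hmult : (mN : ℚ) = (v : ℚ) - 1 -
      ((eN : ℚ) + 1) * (k : ℚ) * ((k : ℚ) - (eN : ℚ)) / ((m : ℚ) * ((eN : ℚ) - (eP : ℚ))))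
    (hbound : (v : ℤ) * eN = (mN : ℤ) * (eN - (k : ℤ)))
    (Y₁ Y₂ Y₃ : Finset V)
    (h₁ : IsDelsarteCoclique G v k eN Y₁)
    (h₂ : IsDelsarteCoclique G v k eN Y₂)
    (h₃ : IsDelsarteCoclique G v k eN Y₃)
    (h₁₂ : Y₁ ≠ Y₂) (h₁₃ : Y₁ ≠ Y₃) (h₂₃ : Y₂ ≠ Y₃) :
    ((Y₁ ∩ Y₂ ∩ Y₃).card : ℚ)
      = (-(eP : ℚ) ^ 2 + (eP : ℚ)) / ((eP : ℚ) ^ 2 + (eN : ℚ)) := by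
  have hlm : (l : ℤ) - m = eP + eN := by
    have hne : eP - eN ≠ 0 := by lia
    apply mul_left_cancel₀ hne
    linear_combination hNroot - hProot
  have hkm : (k : ℤ) - m = -(eP * eN) := by linear_combination -hProot - eP * hlm
  have hcard {Y : Finset V} (hY : IsDelsarteCoclique G v k eN Y) : (Y.card : ℤ) = mN := by
    have hne : eN - (k : ℤ) ≠ 0 := by lia
    apply mul_right_cancel₀ hne
    rw [hY.2, hbound]
  have hcard₁₂ : Y₁.card = Y₂.card := by exact_mod_cast (hcard h₁).trans (hcard h₂).symm
  have hnontrivial : Nontrivial V := by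
    obtain ⟨y, hy₂, hy₁⟩ : ∃ y ∈ Y₂, y ∉ Y₁ := by
      by_contra! hsub
      exact h₁₂ (Finset.eq_of_subset_of_card_le hsub hcard₁₂.le).symm
    obtain ⟨x, hx₁, hx₂⟩ : ∃ x ∈ Y₁, x ∉ Y₂ := by
      by_contra! hsub
      exact h₁₂ (Finset.eq_of_subset_of_card_le hsub hcard₁₂.ge)
    exact ⟨x, y, fun hxy => hx₂ (hxy ▸ hy₂)⟩
  obtain ⟨hm, hv, hk, hc⟩ :=
    hsrg.parameters_of_bounds_eq hconn hconnCompl heP heN hlm hkm hmult hbound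
  obtain ⟨hA, ha₁₂⟩ := h₁.pair_intersection hsrg hlm hkm hm heP heN hv hk h₂ (hcard h₁) (hcard h₂)
    hc h₁₂
  obtain ⟨-, ha₁₃⟩ := h₁.pair_intersection hsrg hlm hkm hm heP heN hv hk h₃ (hcard h₁) (hcard h₃)
    hc h₁₃
  obtain ⟨-, ha₂₃⟩ := h₂.pair_intersection hsrg hlm hkm hm heP heN hv hk h₃ (hcard h₂) (hcard h₃)
    hc h₂₃
  have hA₃ := h₃.adjMatrix_mulVec_charVec hsrg hlm hkm (by rw [hcard h₃, hc])
  have hone : (1 : V → ℤ) ⬝ᵥ Y₃.charVec = mN := by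
    rw [dotProduct_comm, Finset.charVec_dotProduct_one, hcard h₃]
  have hcount : -eN * (((Y₁ ∩ Y₂).card : ℤ) - (Y₁ ∩ Y₂ ∩ Y₃).card) =
      eP * (mN - (Y₁ ∩ Y₃).card - (Y₂ ∩ Y₃).card + (Y₁ ∩ Y₂ ∩ Y₃).card) := by
    have hdot := G.dotProduct_adjMatrix_mulVec (Y₁.charVec * Y₂.charVec) Y₃.charVec
    have hexp : (1 - Y₁.charVec) * (1 - Y₂.charVec) =
        1 - Y₁.charVec - Y₂.charVec + (Y₁ ∩ Y₂).charVec := by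
      rw [← Finset.charVec_mul]
      ring
    rw [hA, hA₃, hexp, Finset.charVec_mul] at hdot
    simp only [dotProduct_smul, smul_dotProduct, dotProduct_sub, sub_dotProduct, add_dotProduct,
      Finset.charVec_dotProduct, Finset.charVec_dotProduct_one, hone, smul_eq_mul] at hdot
    exact hdot
  have hmD : (m : ℤ) * (1 + eP) = eN * (eP ^ 2 + eN) := by
    linear_combination hk - (1 + eP) * hkm
  have hD : eP ^ 2 + eN ≠ 0 := by
    intro h0
    rw [h0, mul_zero] at hmD
    have : 0 < (m : ℤ) * (1 + eP) := by positivity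
    lia
  have hcD : (mN : ℤ) * (eP ^ 2 + eN) = eP + eP ^ 2 + eP * eN - eN ^ 2 := by
    apply mul_left_cancel₀ heN.ne
    linear_combination (1 + eP) * hc - (mN : ℤ) * hmD - eN * hk
  have ht : ((Y₁ ∩ Y₂ ∩ Y₃).card : ℤ) * (eP ^ 2 + eN) = -eP ^ 2 + eP := by
    have hne : eP - eN ≠ 0 := by lia
    apply mul_left_cancel₀ hne
    linear_combination -(eP ^ 2 + eN) * hcount + eN * ha₁₂ - eP * ha₁₃ - eP * ha₂₃
      + (eP - eN) * hcD
  have hDQ : (eP : ℚ) ^ 2 + eN ≠ 0 := by exact_mod_cast hD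
  rw [eq_div_iff hDQ]
  exact_mod_cast ht
end
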